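/- Let D=(V,A) be a digraph, S a multiset of vertices in V, ℓ, ℓ' non-negative integers, and M a matroid on S with rank function r_M. There exists an M-reachability-based (ℓ,ℓ')-limited packing of arborescences in D if and only if: (i) ℓ ≤ ℓ'; (ii) Σ_{v∈V} r_M(S_v) ≥ ℓ; (iii) d⁻_A(X) ≥ p̂(X) for every biset X on V; and (iv) Σ_{X∈𝒫} (r_M(S_{P_{X_I}}) − r_M(S_{X_W}) − d⁻_A(X_O)) ≤ ℓ' for every OW-laminar family 𝒫 ⊆ 𝒳 of generalized petal bisets. -/

import Mathlib

open Finset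

attribute [local instance] Classical.propDecidable

section Defs

variable {V α : Type} [Fintype V] [DecidableEq V] [Fintype α] [DecidableEq α]

/-- One step along an arc of the arc set `B`, for a digraph given by tail and head maps. -/
def DStep (tl hd : α → V) (B : Finset α) (u w : V) : Prop :=
  ∃ a ∈ B, tl a = u ∧ hd a = w

/-- Reachability by a directed path using only arcs of `B`. -/
def DReach (tl hd : α → V) (B : Finset α) : V → V → Prop :=
  Relation.ReflTransGen (DStep tl hd B)

/-- In-degree of a vertex set `X`, counting arcs of `B` with tail outside `X` and head in `X`. -/
noncomputable def inDegB (tl hd : α → V) (B : Finset α) (X : Finset V) : ℕ :=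
  (B.filter fun a => tl a ∉ X ∧ hd a ∈ X).card

/-- `PReach X` is the set of vertices from which some vertex of `X` is reachable. -/
noncomputable def PReach (tl hd : α → V) (X : Finset V) : Finset V :=
  univ.filter fun u => ∃ w ∈ X, DReach tl hd univ u w

/-- A subatom: a non-empty set of pairwise mutually reachable vertices. -/
def IsSubatom (tl hd : α → V) (C : Finset V) : Prop :=
  C.Nonempty ∧ ∀ u ∈ C, ∀ w ∈ C, DReach tl hd univ u w

/-- An atom: a maximal subatom, i.e. a strongly connected component. -/
def IsAtomOf (tl hd : α → V) (C : Finset V) : Prop :=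
  IsSubatom tl hd C ∧ ∀ C', IsSubatom tl hd C' → C ⊆ C' → C' = C

/-- A petal: `Z` meets an atom `C`, `Z ⊆ P_C`, and no arc enters `Z - C`. -/
def IsPetal (tl hd : α → V) (Z : Finset V) : Prop :=
  ∃ C, IsAtomOf tl hd C ∧ (Z ∩ C).Nonempty ∧ Z ⊆ PReach tl hd C ∧
    inDegB tl hd univ (Z \ C) = 0

/-- The (unique) atom witnessing that `Z` is a petal. -/
noncomputable def petalAtom (tl hd : α → V) (Z : Finset V) : Finset V :=
  if h : IsPetal tl hd Z then h.choose else ∅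

/-- The core of a petal `Z`. -/
noncomputable def petalCore (tl hd : α → V) (Z : Finset V) : Finset V :=
  petalAtom tl hd Z ∩ Z

/-- An `R`-branching with vertex set `U` and arc set `F`: roots have in-degree 0,
every other vertex of `U` has in-degree exactly 1, and every vertex of `U` is
reachable from some root (equivalently, unique paths from the root set). -/
def IsBranching (tl hd : α → V) (F : Finset α) (R U : Finset V) : Prop :=
  R ⊆ U ∧ (∀ a ∈ F, tl a ∈ U ∧ hd a ∈ U) ∧
  (∀ a ∈ F, hd a ∉ R) ∧
  (∀ w ∈ U, w ∉ R → (F.filter fun a => hd a = w).card = 1) ∧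
  (∀ w ∈ U, ∃ s ∈ R, DReach tl hd F s w)

/-- An `s`-arborescence with vertex set `U` and arc set `F`. -/
def IsArbor (tl hd : α → V) (F : Finset α) (s : V) (U : Finset V) : Prop :=
  IsBranching tl hd F {s} U

end Defs

/-- A matroid on a finite ground set `σ`, given by its rank function. -/
structure RankFn (σ : Type) [DecidableEq σ] [Fintype σ] where
  r : Finset σ → ℕ
  r_empty : r ∅ = 0
  r_le_card : ∀ X, r X ≤ X.card
  r_mono : ∀ ⦃X Y : Finset σ⦄, X ⊆ Y → r X ≤ r Y
  r_submod : ∀ X Y, r (X ∪ Y) + r (X ∩ Y) ≤ r X + r Y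

/-- `B` is a basis of `T` for the rank function `r`. -/
def IsBasisOf {σ : Type} [DecidableEq σ] [Fintype σ]
    (r : Finset σ → ℕ) (B T : Finset σ) : Prop :=
  B ⊆ T ∧ r B = B.card ∧ r B = r T

/-- For a multiset `S` of vertices given by `loc : σ → V`, the sub-multiset `S_X`
of elements lying in `X`. -/
noncomputable def SX {V σ : Type} [DecidableEq V] [Fintype σ]
    (loc : σ → V) (X : Finset V) : Finset σ :=
  univ.filter fun s => loc s ∈ X

/-- The number of arcs of `B` entering the biset `(XO, XI)`. -/
noncomputable def bisetInDeg {V α : Type} [Fintype V] [DecidableEq V]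
    [Fintype α] [DecidableEq α]
    (tl hd : α → V) (B : Finset α) (XO XI : Finset V) : ℕ :=
  (B.filter fun a => tl a ∉ XO ∧ hd a ∈ XI).card

/-- The biset function `p̂`: `p̂(X) = r_M(S_{P_{C_Z}}) − r_M(S_{X_O})` if
`X = (Z, C_Z ∩ Z)` for a petal `Z`, and `0` otherwise. -/
noncomputable def phatB {V α σ : Type} [Fintype V] [DecidableEq V]
    [Fintype α] [DecidableEq α] [Fintype σ] [DecidableEq σ]
    (tl hd : α → V) (loc : σ → V) (M : RankFn σ) (XO XI : Finset V) : ℤ :=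
  if IsPetal tl hd XO ∧ XI = petalCore tl hd XO then
    (M.r (SX loc (PReach tl hd (petalAtom tl hd XO))) : ℤ) - M.r (SX loc XO)
  else 0


set_option linter.unusedSectionVars false

namespace RankFn

variable {σ : Type} [DecidableEq σ] [Fintype σ] (M : RankFn σ)

theorem r_insert_le (s : σ) (A : Finset σ) : M.r (insert s A) ≤ M.r A + 1 := by
  have h1 := M.r_submod {s} A
  have h2 := M.r_le_card {s}
  rw [card_singleton] at h2
  rw [← insert_eq] at h1
  omega

theorem r_insert_eq_of_subset {s : σ} {A A' : Finset σ} (h : A ⊆ A')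
    (hs : M.r (insert s A) = M.r A) : M.r (insert s A') = M.r A' := by
  have h1 := M.r_submod (insert s A) A'
  have h2 : insert s A ∪ A' = insert s A' := by
    rw [insert_union, union_eq_right.2 h]
  have h3 : M.r A ≤ M.r (insert s A ∩ A') :=
    M.r_mono (subset_inter (subset_insert _ _) h)
  have h4 : M.r A' ≤ M.r (insert s A') := M.r_mono (subset_insert _ _)
  rw [h2] at h1
  omega

theorem r_union_eq {A X : Finset σ} (h : ∀ s ∈ X, M.r (insert s A) = M.r A) :
    M.r (A ∪ X) = M.r A := by
  induction X using Finset.induction_on with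
  | empty => simp
  | insert a X _ ih =>
    rw [union_insert, M.r_insert_eq_of_subset subset_union_left (h a (mem_insert_self _ _))]
    exact ih fun s hs => h s (mem_insert_of_mem hs)

theorem r_insert_eq_of_r_union_eq {s : σ} {A A' : Finset σ} (h : M.r (A ∪ A') = M.r A)
    (hs : M.r (insert s A') = M.r A') : M.r (insert s A) = M.r A := by
  have h1 := M.r_insert_eq_of_subset (subset_union_right (s₁ := A)) hs
  have h2 : M.r (insert s A) ≤ M.r (insert s (A ∪ A')) :=
    M.r_mono (insert_subset_insert _ subset_union_left)
  have h3 : M.r A ≤ M.r (insert s A) := M.r_mono (subset_insert _ _)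
  omega

theorem r_eq_card_of_subset {A B : Finset σ} (h : A ⊆ B) (hB : M.r B = B.card) :
    M.r A = A.card := by
  have h1 := M.r_submod A (B \ A)
  have h2 := M.r_le_card A
  have h3 := M.r_le_card (B \ A)
  have h4 := card_sdiff_add_card_eq_card h
  rw [union_sdiff_of_subset h] at h1
  omega

end RankFn

section Branching

variable {V α σ : Type} [Fintype V] [DecidableEq V] [Fintype α] [DecidableEq α]
  [Fintype σ] [DecidableEq σ] {tl hd : α → V}

theorem DReach.mono {B B' : Finset α} (h : B ⊆ B') {u w : V} (hr : DReach tl hd B u w) :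
    DReach tl hd B' u w := by
  have hle : DStep tl hd B ≤ DStep tl hd B' := fun _ _ ⟨a, ha, h'⟩ => ⟨a, h ha, h'⟩
  exact Relation.ReflTransGen.mono hle _ _ hr

/-- Attaching a new leaf to an arborescence. -/
theorem IsArbor.insert_arc {F : Finset α} {s : V} {U U' : Finset V} (h : IsArbor tl hd F s U)
    {a : α} (ht : tl a ∈ U) (hh : hd a ∉ U) (hU : ∀ x, x ∈ U' ↔ x = hd a ∨ x ∈ U) :
    IsArbor tl hd (insert a F) s U' := by
  obtain ⟨hR, hend, hroot, hdeg, hreach⟩ := h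
  have hsU : s ∈ U := hR (mem_singleton_self _)
  refine ⟨?_, ?_, ?_, ?_, ?_⟩
  · intro x hx
    exact (hU x).2 (Or.inr (hR hx))
  · intro b hb
    rcases mem_insert.1 hb with rfl | hb
    · exact ⟨(hU _).2 (Or.inr ht), (hU _).2 (Or.inl rfl)⟩
    · exact ⟨(hU _).2 (Or.inr (hend b hb).1), (hU _).2 (Or.inr (hend b hb).2)⟩
  · intro b hb
    rcases mem_insert.1 hb with rfl | hb
    · intro hs
      rw [mem_singleton] at hs
      exact hh (hs ▸ hsU)
    · exact hroot b hb
  · intro w hw hws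
    by_cases hwa : w = hd a
    · subst hwa
      rw [card_eq_one]
      refine ⟨a, ?_⟩
      ext b
      simp only [mem_filter, mem_insert, mem_singleton]
      constructor
      · rintro ⟨rfl | hb, hba⟩
        · rfl
        · exact absurd (hba ▸ (hend b hb).2) hh
      · rintro rfl
        exact ⟨Or.inl rfl, rfl⟩
    · have hwU : w ∈ U := ((hU w).1 hw).resolve_left hwa
      rw [filter_insert, if_neg (fun h => hwa h.symm)]
      exact hdeg w hwU hws
  · intro w hw
    rcases (hU w).1 hw with rfl | hw
    · obtain ⟨x, hx, hxr⟩ := hreach _ ht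
      exact ⟨x, hx, Relation.ReflTransGen.tail (hxr.mono (subset_insert _ _))
        ⟨a, mem_insert_self _ _, rfl, rfl⟩⟩
    · obtain ⟨x, hx, hxr⟩ := hreach _ hw
      exact ⟨x, hx, hxr.mono (subset_insert _ _)⟩

/-- A partially built packing: `Q v` lists the roots whose arborescence already contains `v`,
`B` is the set of unused arcs and `F s` the arc set of the arborescence of `s`. -/
structure PartialPacking (tl hd : α → V) (loc : σ → V) (T : Finset σ) (Q : V → Finset σ)
    (B : Finset α) (F : σ → Finset α) : Prop where
  arbor : ∀ s ∈ T, IsArbor tl hd (F s) (loc s) (univ.filter fun v => s ∈ Q v)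
  subset : ∀ v, Q v ⊆ T
  disjoint : ∀ s ∈ T, ∀ s' ∈ T, s ≠ s' → Disjoint (F s) (F s')
  unused : ∀ s ∈ T, Disjoint (F s) B

theorem PartialPacking.move {loc : σ → V} {T : Finset σ} {Q : V → Finset σ} {B : Finset α}
    {F : σ → Finset α} (h : PartialPacking tl hd loc T Q B F) {a : α} (ha : a ∈ B) {s : σ}
    (ht : s ∈ Q (tl a)) (hh : s ∉ Q (hd a)) :
    PartialPacking tl hd loc T (Function.update Q (hd a) (insert s (Q (hd a)))) (B.erase a)
      (Function.update F s (insert a (F s))) := by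
  have hsT : s ∈ T := h.subset _ ht
  have hmem : ∀ s' v, s' ∈ Function.update Q (hd a) (insert s (Q (hd a))) v ↔
      (s' = s ∧ v = hd a) ∨ s' ∈ Q v := by
    intro s' v
    by_cases hv : v = hd a
    · subst hv
      simp
    · simp [hv]
  refine ⟨?_, ?_, ?_, ?_⟩
  · intro s' hs'
    by_cases hss : s' = s
    · subst hss
      rw [Function.update_self]
      refine (h.arbor s' hs').insert_arc (a := a) (by simpa using ht) (by simpa using hh) ?_
      intro x
      simp only [mem_filter, mem_univ, true_and, hmem]
    · rw [Function.update_of_ne hss]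
      have : (univ.filter fun v => s' ∈ Function.update Q (hd a) (insert s (Q (hd a))) v) =
          univ.filter fun v => s' ∈ Q v := by
        ext v
        simp only [mem_filter, mem_univ, true_and, hmem, hss, false_and, false_or]
      rw [this]
      exact h.arbor s' hs'
  · intro v x hx
    rcases (hmem x v).1 hx with ⟨rfl, _⟩ | hx
    · exact hsT
    · exact h.subset v hx
  · have key : ∀ s' ∈ T, s' ≠ s → Disjoint (insert a (F s)) (F s') := by
      intro s' hs' hne
      rw [disjoint_insert_left]
      exact ⟨fun h' => disjoint_left.1 (h.unused s' hs') h' ha, h.disjoint s hsT s' hs' hne.symm⟩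
    intro s₁ h₁ s₂ h₂ hne
    by_cases e₁ : s₁ = s
    · subst e₁
      rw [Function.update_self, Function.update_of_ne hne.symm]
      exact key s₂ h₂ hne.symm
    · by_cases e₂ : s₂ = s
      · subst e₂
        rw [Function.update_self, Function.update_of_ne e₁]
        exact (key s₁ h₁ e₁).symm
      · rw [Function.update_of_ne e₁, Function.update_of_ne e₂]
        exact h.disjoint s₁ h₁ s₂ h₂ hne
  · intro s' hs'
    by_cases e : s' = s
    · subst e
      rw [Function.update_self, disjoint_insert_left]
      exact ⟨notMem_erase _ _, (h.unused s' hs').mono_right (erase_subset _ _)⟩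
    · rw [Function.update_of_ne e]
      exact (h.unused s' hs').mono_right (erase_subset _ _)

/-- Number of arcs of `B` entering `X` with head in `C`. -/
noncomputable def inDegOn (tl hd : α → V) (B : Finset α) (C X : Finset V) : ℕ :=
  (B.filter fun a => tl a ∉ X ∧ hd a ∈ X ∧ hd a ∈ C).card

theorem inDegOn_submod (B : Finset α) (C X Y : Finset V) :
    inDegOn tl hd B C (X ∪ Y) + inDegOn tl hd B C (X ∩ Y) ≤
      inDegOn tl hd B C X + inDegOn tl hd B C Y := by
  unfold inDegOn
  simp only [card_filter]
  rw [← sum_add_distrib, ← sum_add_distrib]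
  refine sum_le_sum fun a _ => ?_
  by_cases h1 : tl a ∈ X <;> by_cases h2 : tl a ∈ Y <;> by_cases h3 : hd a ∈ X <;>
    by_cases h4 : hd a ∈ Y <;> by_cases h5 : hd a ∈ C <;> simp [h1, h2, h3, h4, h5]

theorem r_biUnion_submod (M : RankFn σ) (Q : V → Finset σ) (X Y : Finset V) {s : σ}
    (hs : s ∈ X.biUnion Q) :
    M.r ((X ∪ Y).biUnion Q) + M.r (insert s ((X ∩ Y).biUnion Q)) ≤
      M.r (X.biUnion Q) + M.r (insert s (Y.biUnion Q)) := by
  refine le_trans (add_le_add (M.r_mono ?_) (M.r_mono ?_)) (M.r_submod _ _)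
  · intro x hx
    simp only [mem_biUnion, mem_union, mem_insert] at hx ⊢
    obtain ⟨v, hv | hv, hx⟩ := hx
    · exact Or.inl ⟨v, hv, hx⟩
    · exact Or.inr (Or.inr ⟨v, hv, hx⟩)
  · intro x hx
    rcases mem_insert.1 hx with rfl | hx
    · exact mem_inter.2 ⟨hs, mem_insert_self _ _⟩
    · obtain ⟨v, hv, hx⟩ := mem_biUnion.1 hx
      rw [mem_inter] at hv
      exact mem_inter.2 ⟨mem_biUnion.2 ⟨v, hv.1, hx⟩,
        mem_insert_of_mem (mem_biUnion.2 ⟨v, hv.2, hx⟩)⟩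

theorem exists_movable_arc (M : RankFn σ) {Q : V → Finset σ} {B : Finset α} {C N : Finset V}
    {E : Finset σ} (hCN : C ⊆ N) (htl : ∀ a ∈ B, hd a ∈ C → tl a ∈ N)
    (hQE : ∀ v ∈ N, Q v ⊆ E)
    (hcut : ∀ X : Finset V, (X ∩ C).Nonempty →
      M.r E ≤ inDegOn tl hd B C X + M.r (X.biUnion Q))
    {v₀ : V} (hv₀ : v₀ ∈ C) (hlt : M.r (Q v₀) < M.r E) :
    ∃ a ∈ B, hd a ∈ C ∧ ∃ s ∈ Q (tl a), M.r (insert s (Q (hd a))) ≠ M.r (Q (hd a)) ∧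
      ∀ X : Finset V, hd a ∈ X → tl a ∉ X →
        inDegOn tl hd B C X + M.r (X.biUnion Q) = M.r E →
        M.r (insert s (X.biUnion Q)) ≠ M.r (X.biUnion Q) := by
  by_contra hbad
  push Not at hbad
  let tight : Finset V → Prop := fun X =>
    inDegOn tl hd B C X + M.r (X.biUnion Q) = M.r E ∧ ∃ v ∈ X ∩ C, M.r (Q v) < M.r (X.biUnion Q)
  have hN : tight N := by
    have h0 : inDegOn tl hd B C N = 0 := by
      unfold inDegOn
      rw [card_eq_zero, filter_eq_empty_iff]
      rintro a ha ⟨h1, -, h2⟩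
      exact h1 (htl a ha h2)
    have h1 := hcut N ⟨v₀, mem_inter.2 ⟨hCN hv₀, hv₀⟩⟩
    have h2 : M.r (N.biUnion Q) ≤ M.r E := M.r_mono (biUnion_subset.2 hQE)
    exact ⟨by omega, v₀, mem_inter.2 ⟨hCN hv₀, hv₀⟩, by omega⟩
  obtain ⟨X, hX, hmin⟩ := exists_minimal (s := univ.filter tight) ⟨N, by simpa using hN⟩
  simp only [mem_filter, mem_univ, true_and] at hX hmin
  obtain ⟨htX, v, hv, hvlt⟩ := hX
  obtain ⟨hvX, hvC⟩ := mem_inter.1 hv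
  set D := X.filter fun u => M.r (Q v ∪ Q u) = M.r (Q v) with hD
  have hvD : v ∈ D := by simp [hD, hvX]
  have hrD : M.r (D.biUnion Q) ≤ M.r (Q v) := by
    have : M.r (Q v ∪ D.biUnion Q) = M.r (Q v) := by
      apply M.r_union_eq
      intro s hs
      obtain ⟨u, hu, hsu⟩ := mem_biUnion.1 hs
      have h1 := (mem_filter.1 hu).2
      refine M.r_insert_eq_of_r_union_eq h1 ?_
      rw [insert_eq_of_mem hsu]
    rw [← this]
    exact M.r_mono subset_union_right
  have hcD := hcut D ⟨v, mem_inter.2 ⟨hvD, hvC⟩⟩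
  obtain ⟨a, haB, hatl, hahd, haC, haX⟩ : ∃ a ∈ B, tl a ∉ D ∧ hd a ∈ D ∧ hd a ∈ C ∧ tl a ∈ X := by
    by_contra hno
    push Not at hno
    have : inDegOn tl hd B C D ≤ inDegOn tl hd B C X := by
      refine card_le_card fun a ha => ?_
      simp only [mem_filter] at ha ⊢
      exact ⟨ha.1, hno a ha.1 ha.2.1 ha.2.2.1 ha.2.2.2, (mem_filter.1 ha.2.2.1).1, ha.2.2.2⟩
    omega
  obtain ⟨s, hs, hsv⟩ : ∃ s ∈ Q (tl a), M.r (insert s (Q v)) ≠ M.r (Q v) := by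
    by_contra hno
    push Not at hno
    exact hatl (mem_filter.2 ⟨haX, M.r_union_eq hno⟩)
  have hvw : M.r (Q v ∪ Q (hd a)) = M.r (Q v) := (mem_filter.1 hahd).2
  have hwX : hd a ∈ X := (mem_filter.1 hahd).1
  obtain ⟨Y, hwY, huY, htY, hsY⟩ := hbad a haB haC s hs
    fun h => hsv (M.r_insert_eq_of_r_union_eq hvw h)
  have hwXY : hd a ∈ (X ∩ Y) ∩ C := mem_inter.2 ⟨mem_inter.2 ⟨hwX, hwY⟩, haC⟩
  have h1 := inDegOn_submod (tl := tl) (hd := hd) B C X Y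
  have h2 := r_biUnion_submod M Q X Y (mem_biUnion.2 ⟨tl a, haX, hs⟩)
  have h3 := hcut (X ∪ Y) ⟨hd a, mem_inter.2 ⟨mem_union_left _ hwX, haC⟩⟩
  have h4 := hcut (X ∩ Y) ⟨hd a, hwXY⟩
  have h5 : M.r ((X ∩ Y).biUnion Q) ≤ M.r (insert s ((X ∩ Y).biUnion Q)) :=
    M.r_mono (subset_insert _ _)
  have hw : M.r (Q (hd a)) = M.r ((X ∩ Y).biUnion Q) := by
    have hle : M.r (Q (hd a)) ≤ M.r ((X ∩ Y).biUnion Q) :=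
      M.r_mono (subset_biUnion_of_mem Q (mem_inter.1 hwXY).1)
    by_contra hne
    have ht : tight (X ∩ Y) := ⟨by omega, hd a, hwXY, by omega⟩
    exact huY (mem_inter.1 (hmin ht inter_subset_left haX)).2
  apply hsv
  refine M.r_insert_eq_of_r_union_eq hvw (M.r_insert_eq_of_r_union_eq
    (A' := (X ∩ Y).biUnion Q) ?_ (by omega))
  rw [union_eq_right.2 (subset_biUnion_of_mem Q (mem_inter.1 hwXY).1), hw]

theorem PartialPacking.complete (M : RankFn σ) {loc : σ → V} {T : Finset σ} {C N : Finset V}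
    {E : Finset σ} (hCN : C ⊆ N) {B : Finset α} : ∀ {Q : V → Finset σ} {F : σ → Finset α},
    PartialPacking tl hd loc T Q B F → (∀ a ∈ B, hd a ∈ C → tl a ∈ N) →
    (∀ v ∈ N, Q v ⊆ E) → (∀ v ∈ C, M.r (Q v) = (Q v).card) →
    (∀ X : Finset V, (X ∩ C).Nonempty →
      M.r E ≤ inDegOn tl hd B C X + M.r (X.biUnion Q)) →
    ∃ Q' B' F', PartialPacking tl hd loc T Q' B' F' ∧ (∀ v ∈ C, IsBasisOf M.r (Q' v) E) ∧
      (∀ v ∉ C, Q' v = Q v) ∧ ∀ a ∈ B, hd a ∉ C → a ∈ B' := by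
  induction hn : B.card generalizing B with
  | zero =>
    intro Q F h htl hQE hind hcut
    refine ⟨Q, B, F, h, fun v hv => ⟨hQE v (hCN hv), hind v hv, ?_⟩, fun _ _ => rfl,
      fun _ ha _ => ha⟩
    have := hcut {v} ⟨v, by simp [hv]⟩
    have h2 : M.r (Q v) ≤ M.r E := M.r_mono (hQE v (hCN hv))
    rw [singleton_biUnion, inDegOn, card_eq_zero.1 hn] at this
    simp at this
    omega
  | succ n ih =>
    intro Q F h htl hQE hind hcut
    by_cases hall : ∀ v ∈ C, M.r (Q v) = M.r E
    · exact ⟨Q, B, F, h, fun v hv => ⟨hQE v (hCN hv), hind v hv, hall v hv⟩, fun _ _ => rfl,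
        fun _ ha _ => ha⟩
    push Not at hall
    obtain ⟨v₀, hv₀, hne⟩ := hall
    obtain ⟨a, ha, haC, s, hs, hsh, hX⟩ := exists_movable_arc M hCN htl hQE hcut hv₀
      (lt_of_le_of_ne (M.r_mono (hQE v₀ (hCN hv₀))) hne)
    have hsn : s ∉ Q (hd a) := fun h' => hsh (by rw [insert_eq_of_mem h'])
    have hne' : ∀ v, v ≠ hd a → Function.update Q (hd a) (insert s (Q (hd a))) v = Q v :=
      fun v hv => Function.update_of_ne hv _ _
    have hsub : ∀ v, Q v ⊆ Function.update Q (hd a) (insert s (Q (hd a))) v := by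
      intro v
      by_cases hv : v = hd a
      · subst hv
        simp
      · rw [hne' v hv]
    have hQE' : ∀ v ∈ N, Function.update Q (hd a) (insert s (Q (hd a))) v ⊆ E := by
      intro v hv
      by_cases hva : v = hd a
      · subst hva
        rw [Function.update_self]
        exact insert_subset (hQE _ (htl a ha haC) hs) (hQE _ hv)
      · rw [hne' v hva]
        exact hQE v hv
    have hind' : ∀ v ∈ C, M.r (Function.update Q (hd a) (insert s (Q (hd a))) v) =
        (Function.update Q (hd a) (insert s (Q (hd a))) v).card := by
      intro v hv
      by_cases hva : v = hd a
      · subst hva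
        rw [Function.update_self, card_insert_of_notMem hsn]
        have h1 := M.r_insert_le s (Q (hd a))
        have h2 : M.r (Q (hd a)) ≤ M.r (insert s (Q (hd a))) := M.r_mono (subset_insert _ _)
        have h3 := hind _ hv
        omega
      · rw [hne' v hva]
        exact hind v hv
    have hcut' : ∀ X : Finset V, (X ∩ C).Nonempty → M.r E ≤
        inDegOn tl hd (B.erase a) C X + M.r (X.biUnion (Function.update Q (hd a) (insert s (Q (hd a))))) := by
      intro X hXC
      have h1 := hcut X hXC
      have h2 : M.r (X.biUnion Q) ≤
          M.r (X.biUnion (Function.update Q (hd a) (insert s (Q (hd a))))) :=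
        M.r_mono (biUnion_mono fun v _ => hsub v)
      by_cases hent : hd a ∈ X ∧ tl a ∉ X
      · have h3 : inDegOn tl hd (B.erase a) C X + 1 = inDegOn tl hd B C X := by
          unfold inDegOn
          rw [filter_erase]
          exact card_erase_add_one (by simp [ha, hent, haC])
        have h4 : M.r (insert s (X.biUnion Q)) ≤
            M.r (X.biUnion (Function.update Q (hd a) (insert s (Q (hd a))))) := by
          refine M.r_mono (insert_subset ?_ (biUnion_mono fun v _ => hsub v))
          exact mem_biUnion.2 ⟨hd a, hent.1, by simp⟩
        have h5 : M.r (X.biUnion Q) ≤ M.r (insert s (X.biUnion Q)) :=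
          M.r_mono (subset_insert _ _)
        have h6 := hX X hent.1 hent.2
        by_cases htight : inDegOn tl hd B C X + M.r (X.biUnion Q) = M.r E
        · have := h6 htight
          omega
        · omega
      · have h3 : inDegOn tl hd (B.erase a) C X = inDegOn tl hd B C X := by
          unfold inDegOn
          rw [filter_erase, erase_eq_of_notMem]
          simp only [mem_filter, not_and]
          intro _ h1 h2
          exact absurd ⟨h2, h1⟩ hent
        omega
    obtain ⟨Q', B', F', h', hb, hQ', hB'⟩ := ih (B := B.erase a)
      (by rw [card_erase_of_mem ha, hn]; rfl) (h.move ha hs hsn)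
      (fun b hb => htl b (mem_of_mem_erase hb)) hQE' hind' hcut'
    refine ⟨Q', B', F', h', hb, fun v hv => ?_, fun b hb hbC => hB' b ?_ hbC⟩
    · rw [hQ' v hv, hne']
      rintro rfl
      exact hv haC
    · refine mem_erase.2 ⟨?_, hb⟩
      rintro rfl
      exact hbC haC

end Branching

section Uncrossing

variable {Λ V σ : Type} [Fintype Λ] [DistribLattice Λ] [DecidableEq V] [Fintype σ]
  [DecidableEq σ]

/-- Data describing a family of lattice elements, each with a core and a covered set, on which
crossing pairs with intersecting cores can be uncrossed. -/
structure CrossingSystem (G : Λ → Prop) (core : Λ → Finset V) (J : Λ → Finset σ) (q : Λ → ℤ)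
    (ρ : Λ → ℕ) : Prop where
  closed : ∀ X Y, G X → G Y → (core X ∩ core Y).Nonempty → G (X ⊔ Y) ∧ G (X ⊓ Y)
  supermod : ∀ X Y, G X → G Y → (core X ∩ core Y).Nonempty → q X + q Y ≤ q (X ⊔ Y) + q (X ⊓ Y)
  cover : ∀ X Y, G X → G Y → (core X ∩ core Y).Nonempty → ∀ s,
    (if s ∈ J X then (1 : ℤ) else 0) + (if s ∈ J Y then 1 else 0) =
      (if s ∈ J (X ⊔ Y) then 1 else 0) + (if s ∈ J (X ⊓ Y) then 1 else 0)
  core_nonempty : ∀ X, G X → (core X).Nonempty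
  core_mono : ∀ X Y, X ≤ Y → core X ⊆ core Y
  convex : ∀ X Y Z, G X → G Y → G Z → X ≤ Y → Y ≤ Z → ∀ s, s ∈ J X → s ∈ J Z → s ∈ J Y
  meet : ∀ X Y, G X → G Y → ∀ s, s ∈ J X → s ∈ J Y → (core X ∩ core Y).Nonempty
  rank_strictMono : StrictMono ρ
  rank_modular : ∀ X Y, ρ (X ⊔ Y) + ρ (X ⊓ Y) = ρ X + ρ Y

/-- Weighted value of a multifamily. -/
def famVal (q : Λ → ℤ) (y : Λ → ℕ) : ℤ := ∑ X, (y X : ℤ) * q X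

/-- How many members of a multifamily cover `s`. -/
noncomputable def famCov (J : Λ → Finset σ) (y : Λ → ℕ) (s : σ) : ℤ :=
  famVal (fun X => if s ∈ J X then 1 else 0) y

theorem famVal_add (q : Λ → ℤ) (y z : Λ → ℕ) : famVal q (y + z) = famVal q y + famVal q z := by
  simp [famVal, add_mul, sum_add_distrib]

theorem famVal_single (q : Λ → ℤ) (X : Λ) : famVal q (Pi.single X 1) = q X := by
  simp [famVal, Pi.single_apply]

theorem famVal_nsmul (q : Λ → ℤ) (k : ℕ) (y : Λ → ℕ) : famVal q (k • y) = k * famVal q y := by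
  simp [famVal, mul_sum, mul_assoc]

theorem famCov_nonneg (J : Λ → Finset σ) (y : Λ → ℕ) (s : σ) : 0 ≤ famCov J y s := by
  refine sum_nonneg fun X _ => mul_nonneg (by positivity) ?_
  dsimp only
  split <;> simp

theorem famVal_sub_sum (J : Λ → Finset σ) (q : Λ → ℤ) (D : Finset σ) (m : σ → ℤ) (y : Λ → ℕ) :
    famVal (fun X => q X - ∑ s ∈ D, m s * (if s ∈ J X then 1 else 0)) y =
      famVal q y - ∑ s ∈ D, m s * famCov J y s := by
  simp only [famVal, famCov, mul_sub, sum_sub_distrib, mul_sum]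
  congr 1
  rw [sum_comm]
  refine sum_congr rfl fun s _ => sum_congr rfl fun X _ => by ring

/-- Elements with intersecting cores are comparable. -/
def Uncrossed (core : Λ → Finset V) (P : Λ → Prop) : Prop :=
  ∀ X Y, P X → P Y → (core X ∩ core Y).Nonempty → X ≤ Y ∨ Y ≤ X

variable {G : Λ → Prop} {core : Λ → Finset V} {J : Λ → Finset σ} {q : Λ → ℤ} {ρ : Λ → ℕ}

theorem CrossingSystem.sub_sum (h : CrossingSystem G core J q ρ) (D : Finset σ) (m : σ → ℤ) :
    CrossingSystem G core J (fun X => q X - ∑ s ∈ D, m s * (if s ∈ J X then 1 else 0)) ρ := by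
  refine ⟨h.closed, fun X Y hX hY hXY => ?_, h.cover, h.core_nonempty, h.core_mono, h.convex,
    h.meet, h.rank_strictMono, h.rank_modular⟩
  have h1 := h.supermod X Y hX hY hXY
  have h2 : ∑ s ∈ D, m s * (if s ∈ J X then (1 : ℤ) else 0) +
      ∑ s ∈ D, m s * (if s ∈ J Y then (1 : ℤ) else 0) =
      ∑ s ∈ D, m s * (if s ∈ J (X ⊔ Y) then (1 : ℤ) else 0) +
      ∑ s ∈ D, m s * (if s ∈ J (X ⊓ Y) then (1 : ℤ) else 0) := by
    rw [← sum_add_distrib, ← sum_add_distrib]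
    refine sum_congr rfl fun s _ => ?_
    rw [← mul_add, ← mul_add, h.cover X Y hX hY hXY s]
  linarith

theorem CrossingSystem.exists_uncrossed (h : CrossingSystem G core J q ρ) {y : Λ → ℕ}
    (hy : ∀ X, y X ≠ 0 → G X) :
    ∃ z : Λ → ℕ, (∀ X, z X ≠ 0 → G X) ∧ (∀ s, famCov J z s = famCov J y s) ∧
      famVal q y ≤ famVal q z ∧ Uncrossed core (fun X => z X ≠ 0) := by
  obtain ⟨b, hb⟩ : ∃ b : ℕ, ∀ X, ρ X ≤ b :=
    ⟨univ.sup ρ, fun X => le_sup (mem_univ X)⟩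
  let pot : (Λ → ℕ) → ℤ := fun y => famVal (fun X => (b : ℤ) ^ 2 - (ρ X : ℤ) ^ 2) y
  have hpot : ∀ y, 0 ≤ pot y := by
    intro y
    refine sum_nonneg fun X _ => mul_nonneg (by positivity) ?_
    have : (ρ X : ℤ) ≤ b := by exact_mod_cast hb X
    nlinarith [Int.natCast_nonneg (ρ X)]
  induction hn : (pot y).toNat using Nat.strong_induction_on generalizing y with
  | _ n ih =>
  by_cases hun : Uncrossed core (fun X => y X ≠ 0)
  · exact ⟨y, hy, fun _ => rfl, le_rfl, hun⟩
  unfold Uncrossed at hun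
  push Not at hun
  obtain ⟨X, Y, hX, hY, hXY, hle, hge⟩ := hun
  have hne : X ≠ Y := fun h' => hle h'.le
  obtain ⟨w, hw⟩ : ∃ w, y = w + (Pi.single X 1 + Pi.single Y 1) := by
    refine ⟨y - (Pi.single X 1 + Pi.single Y 1), funext fun Z => ?_⟩
    by_cases h1 : Z = X
    · subst h1
      simp [hne]
      omega
    · by_cases h2 : Z = Y
      · subst h2
        simp [h1]
        omega
      · simp [h1, h2]
  have hGX := hy X hX
  have hGY := hy Y hY
  obtain ⟨hGs, hGi⟩ := h.closed X Y hGX hGY hXY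
  set y' := w + (Pi.single (X ⊔ Y) 1 + Pi.single (X ⊓ Y) 1) with hy'
  have hval : ∀ f : Λ → ℤ, famVal f y' = famVal f y + (f (X ⊔ Y) + f (X ⊓ Y) - f X - f Y) := by
    intro f
    rw [hw, hy']
    simp only [famVal_add, famVal_single]
    ring
  have hG' : ∀ Z, y' Z ≠ 0 → G Z := by
    intro Z hZ
    by_cases h1 : Z = X ⊔ Y
    · exact h1 ▸ hGs
    by_cases h2 : Z = X ⊓ Y
    · exact h2 ▸ hGi
    refine hy Z ?_
    rw [hy'] at hZ
    simp [h1, h2] at hZ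
    simp [hw, hZ]
  have hlt : pot y' < pot y := by
    have h1 : ρ X < ρ (X ⊔ Y) := h.rank_strictMono (lt_of_le_of_ne le_sup_left
      fun h' => hge (h' ▸ le_sup_right))
    have h2 : ρ Y < ρ (X ⊔ Y) := h.rank_strictMono (lt_of_le_of_ne le_sup_right
      fun h' => hle (h' ▸ le_sup_left))
    have h3 := h.rank_modular X Y
    simp only [pot]
    rw [hval]
    zify at h1 h2 h3
    have h4 : (ρ (X ⊓ Y) : ℤ) = ρ X + ρ Y - ρ (X ⊔ Y) := by linarith
    rw [h4]
    nlinarith [mul_pos (sub_pos.2 h1) (sub_pos.2 h2)]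
  obtain ⟨z, hz, hcov, hv, hu⟩ := ih (pot y').toNat
    (by have := hpot y'; have := hpot y; omega) hG' rfl
  refine ⟨z, hz, fun s => ?_, ?_, hu⟩
  · rw [hcov, famCov, hval, famCov]
    have := h.cover X Y hGX hGY hXY s
    linarith
  · refine le_trans ?_ hv
    rw [hval]
    have := h.supermod X Y hGX hGY hXY
    linarith

/-- Alternating signs along a chain add up to `0` or `1`. -/
theorem sum_neg_one_pow_chain (A : Finset Λ) (hA : ∀ X ∈ A, ∀ Y ∈ A, X ≤ Y ∨ Y ≤ X) :
    ∑ X ∈ A, (-1 : ℤ) ^ (A.filter fun Y => X < Y).card = 0 ∨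
      ∑ X ∈ A, (-1 : ℤ) ^ (A.filter fun Y => X < Y).card = 1 := by
  have key : ∑ X ∈ A, (-1 : ℤ) ^ (A.filter fun Y => X < Y).card =
      ∑ i ∈ range A.card, (-1 : ℤ) ^ i := by
    induction hn : A.card generalizing A with
    | zero => simp [card_eq_zero.1 hn]
    | succ n ih =>
      obtain ⟨X, hX, hmin⟩ := A.exists_minimal (card_pos.1 (by omega))
      have hlt : ∀ Y ∈ A, Y ≠ X → X < Y := fun Y hY hne =>
        lt_of_le_of_ne ((hA X hX Y hY).elim id fun h => hmin hY h) hne.symm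
      have hc : (A.erase X).card = n := by rw [card_erase_of_mem hX, hn]; rfl
      rw [← add_sum_erase A _ hX, sum_range_succ, add_comm]
      congr 1
      · rw [← ih (A.erase X) (fun Y hY Z hZ => hA Y (mem_of_mem_erase hY) Z (mem_of_mem_erase hZ))
          hc]
        refine sum_congr rfl fun Y hY => ?_
        congr 2
        ext Z
        simp only [mem_filter, mem_erase]
        have := hlt Y (mem_of_mem_erase hY) (ne_of_mem_erase hY)
        constructor
        · rintro ⟨hZ, hYZ⟩
          exact ⟨⟨(this.trans hYZ).ne', hZ⟩, hYZ⟩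
        · rintro ⟨⟨-, hZ⟩, hYZ⟩
          exact ⟨hZ, hYZ⟩
      · rw [← hc]
        congr 2
        ext Z
        simp only [mem_filter, mem_erase]
        exact ⟨fun ⟨hZ, hXZ⟩ => ⟨hXZ.ne', hZ⟩, fun ⟨hne, hZ⟩ => ⟨hZ, hlt Z hZ hne⟩⟩
  rw [key, neg_one_geom_sum]
  split <;> simp

/-- A chain that is convex in an uncrossed family is balanced by the parity of the depth. -/
theorem CrossingSystem.depth_balanced (h : CrossingSystem G core J q ρ) (R : Finset Λ)
    (hR : ∀ X ∈ R, G X) (hun : Uncrossed core (· ∈ R)) (s : σ) :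
    |∑ X ∈ R.filter (fun X => s ∈ J X), (-1 : ℤ) ^ (R.filter fun Y => X < Y).card| ≤ 1 := by
  set A := R.filter (fun X => s ∈ J X) with hAdef
  have hA : ∀ X ∈ A, ∀ Y ∈ A, X ≤ Y ∨ Y ≤ X := by
    intro X hX Y hY
    obtain ⟨hX, hsX⟩ := mem_filter.1 hX
    obtain ⟨hY, hsY⟩ := mem_filter.1 hY
    exact hun X Y hX hY (h.meet X Y (hR X hX) (hR Y hY) s hsX hsY)
  rcases A.eq_empty_or_nonempty with h0 | hne
  · simp [h0]
  obtain ⟨Z, hZ, hmax⟩ := A.exists_maximal hne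
  have htop : ∀ Y ∈ A, Y ≤ Z := fun Y hY => (hA Y hY Z hZ).elim id fun h' => hmax hY h'
  obtain ⟨hZR, hsZ⟩ := mem_filter.1 hZ
  have hsplit : ∀ X ∈ A, (R.filter fun Y => X < Y).card =
      (A.filter fun Y => X < Y).card + (R.filter fun Y => Z < Y).card := by
    intro X hX
    obtain ⟨hXR, hsX⟩ := mem_filter.1 hX
    rw [← card_union_of_disjoint]
    · congr 1
      ext Y
      simp only [mem_filter, mem_union]
      constructor
      · rintro ⟨hY, hXY⟩
        have hYZ : (core Y ∩ core Z).Nonempty := by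
          refine (h.core_nonempty X (hR X hXR)).mono (subset_inter ?_ ?_)
          · exact h.core_mono X Y hXY.le
          · exact h.core_mono X Z (htop X hX)
        by_cases hle : Y ≤ Z
        · exact Or.inl ⟨mem_filter.2 ⟨hY, h.convex X Y Z (hR X hXR) (hR Y hY) (hR Z hZR) hXY.le
            hle s hsX hsZ⟩, hXY⟩
        · exact Or.inr ⟨hY, lt_of_le_not_ge ((hun Y Z hY hZR hYZ).resolve_left hle) hle⟩
      · rintro (⟨hY, hXY⟩ | ⟨hY, hZY⟩)
        · exact ⟨(mem_filter.1 hY).1, hXY⟩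
        · exact ⟨hY, lt_of_le_of_lt (htop X hX) hZY⟩
    · rw [disjoint_left]
      intro Y hY hY'
      have h1 := htop Y (mem_filter.1 hY).1
      exact absurd (mem_filter.1 hY').2 (not_lt_of_ge h1)
  rw [sum_congr rfl fun X hX => by rw [hsplit X hX, pow_add], ← sum_mul, abs_mul, abs_pow]
  rcases sum_neg_one_pow_chain A hA with h1 | h1 <;> simp [h1]

/-- Every multifamily can be split into two multifamilies of no smaller total value which share
the covering as evenly as possible. -/
theorem CrossingSystem.exists_split (h : CrossingSystem G core J q ρ) {y : Λ → ℕ}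
    (hy : ∀ X, y X ≠ 0 → G X) :
    ∃ y₁ y₂ : Λ → ℕ, (∀ X, y₁ X ≠ 0 → G X) ∧ (∀ X, y₂ X ≠ 0 → G X) ∧
      (∀ s, famCov J y₁ s + famCov J y₂ s = famCov J y s) ∧
      (∀ s, |famCov J y₁ s - famCov J y₂ s| ≤ 1) ∧
      famVal q y ≤ famVal q y₁ + famVal q y₂ := by
  obtain ⟨z, hz, hcov, hval, hun⟩ := h.exists_uncrossed hy
  set R := univ.filter fun X => z X % 2 = 1 with hRdef
  set d : Λ → ℕ := fun X => (R.filter fun Y => X < Y).card with hd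
  set y₁ : Λ → ℕ := fun X => z X / 2 + if X ∈ R ∧ Even (d X) then 1 else 0 with hy₁
  set y₂ : Λ → ℕ := fun X => z X / 2 + if X ∈ R ∧ ¬ Even (d X) then 1 else 0 with hy₂
  have hsum : y₁ + y₂ = z := by
    funext X
    simp only [hy₁, hy₂, Pi.add_apply, hRdef, mem_filter, mem_univ, true_and]
    by_cases h1 : z X % 2 = 1 <;> by_cases h2 : Even (d X) <;> simp [h1, h2] <;> omega
  have hadd : ∀ f : Λ → ℤ, famVal f y₁ + famVal f y₂ = famVal f z := fun f => by
    rw [← famVal_add, hsum]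
  refine ⟨y₁, y₂, fun X hX => hz X ?_, fun X hX => hz X ?_, fun s => ?_, fun s => ?_, ?_⟩
  · rw [← hsum, Pi.add_apply]
    omega
  · rw [← hsum, Pi.add_apply]
    omega
  · rw [← hcov s]
    exact hadd _
  · have hRG : ∀ X ∈ R, z X ≠ 0 := by
      intro X hX h0
      have := (mem_filter.1 hX).2
      omega
    have := h.depth_balanced R (fun X hX => hz X (hRG X hX))
      (fun X Y hX hY => hun X Y (hRG X hX) (hRG Y hY)) s
    convert this using 2
    rw [famCov, famCov, famVal, famVal, ← sum_sub_distrib, sum_filter, hRdef, sum_filter]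
    refine sum_congr rfl fun X _ => ?_
    have hX : X ∈ R ↔ z X % 2 = 1 := by simp [hRdef]
    simp only [hy₁, hy₂, hX]
    by_cases h1 : z X % 2 = 1 <;> by_cases h2 : Even (d X) <;> by_cases h3 : s ∈ J X <;>
      simp [h1, h2, h3]
    · exact (Even.neg_one_pow h2).symm
    · exact (Odd.neg_one_pow (Nat.not_even_iff_odd.1 h2)).symm
  · rw [hadd]
    exact hval

/-- Min-max theorem for crossing systems: an integral covering vector of total at most `ℓ`
exists provided every uncrossed subfamily with disjoint covered sets has value at most `ℓ`. -/
theorem CrossingSystem.exists_cover (h : CrossingSystem G core J q ρ) (ℓ : ℕ)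
    (hempty : ∀ X, G X → J X = ∅ → q X ≤ 0)
    (hfam : ∀ R : Finset Λ, (∀ X ∈ R, G X) → Uncrossed core (· ∈ R) →
      (∀ X ∈ R, ∀ Y ∈ R, X ≠ Y → Disjoint (J X) (J Y)) → ∑ X ∈ R, q X ≤ ℓ) :
    ∃ m : σ → ℤ, (∀ s, 0 ≤ m s) ∧ ∑ s, m s ≤ ℓ ∧ ∀ X, G X → q X ≤ ∑ s ∈ J X, m s := by
  have key : ∀ D : Finset σ, ∃ m : σ → ℤ, (∀ s, 0 ≤ m s) ∧ ∀ y : Λ → ℕ, (∀ X, y X ≠ 0 → G X) →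
      (∀ s ∉ D, famCov J y s ≤ 1) →
      famVal q y - ∑ s ∈ D, m s * famCov J y s + ∑ s ∈ D, m s ≤ ℓ := by
    intro D
    induction D using Finset.induction_on with
    | empty =>
      refine ⟨0, fun _ => le_rfl, fun y hy hcov => ?_⟩
      obtain ⟨z, hz, hzc, hv, hun⟩ := h.exists_uncrossed hy
      simp only [sum_empty, sub_zero, add_zero]
      refine hv.trans ?_
      have hmul : ∀ X s, s ∈ J X → (z X : ℤ) ≤ 1 := by
        intro X s hs
        refine le_trans ?_ ((hzc s).trans_le (hcov s (notMem_empty _)))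
        have := single_le_sum (f := fun X => (z X : ℤ) * if s ∈ J X then 1 else 0) (s := univ)
          (fun X _ => mul_nonneg (by positivity) (by split <;> simp)) (mem_univ X)
        simpa [hs, famCov, famVal] using this
      refine le_trans ?_ (hfam (univ.filter fun X => z X ≠ 0 ∧ (J X).Nonempty) ?_ ?_ ?_)
      · rw [sum_filter]
        refine sum_le_sum fun X _ => ?_
        by_cases h0 : z X = 0
        · simp [h0]
        rcases (J X).eq_empty_or_nonempty with he | ⟨s, hs⟩
        · simp only [he, Finset.not_nonempty_empty, and_false, if_false]
          exact mul_nonpos_of_nonneg_of_nonpos (by positivity) (hempty X (hz X h0) he)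
        · have h1 := hmul X s hs
          have h2 : z X = 1 := by omega
          simp [h2, show (J X).Nonempty from ⟨s, hs⟩]
      · intro X hX
        exact hz X (mem_filter.1 hX).2.1
      · intro X Y hX hY
        exact hun X Y (mem_filter.1 hX).2.1 (mem_filter.1 hY).2.1
      · intro X hX Y hY hne
        rw [disjoint_left]
        intro s hsX hsY
        have h1 := (mem_filter.1 hX).2.1
        have h2 := (mem_filter.1 hY).2.1
        have h3 := (hzc s).trans_le (hcov s (notMem_empty _))
        have h4 : ∑ W ∈ ({X, Y} : Finset Λ), (z W : ℤ) * (if s ∈ J W then 1 else 0) ≤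
            famCov J z s :=
          sum_le_sum_of_subset_of_nonneg (subset_univ _)
            (fun X _ _ => mul_nonneg (by positivity) (by split <;> simp))
        rw [sum_pair hne] at h4
        simp only [hsX, hsY, if_true, mul_one] at h4
        omega
    | insert v D hv ih =>
      obtain ⟨m, hm, hH⟩ := ih
      let w : (Λ → ℕ) → ℤ :=
        famVal (fun X => q X - ∑ s ∈ D, m s * (if s ∈ J X then 1 else 0))
      have hw : ∀ y, w y = famVal q y - ∑ s ∈ D, m s * famCov J y s :=
        fun y => famVal_sub_sum J q D m y
      have hsys := h.sub_sum D m
      obtain ⟨L, hL⟩ : ∃ L : ℤ, L = ℓ - ∑ s ∈ D, m s := ⟨_, rfl⟩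
      have hH' : ∀ y : Λ → ℕ, (∀ X, y X ≠ 0 → G X) → (∀ s ∉ D, famCov J y s ≤ 1) → w y ≤ L := by
        intro y hy hc
        have := hH y hy hc
        rw [hw, hL]
        linarith
      let ok : (Λ → ℕ) → Prop := fun y =>
        (∀ X, y X ≠ 0 → G X) ∧ (∀ s ∉ insert v D, famCov J y s ≤ 1)
      have hoff : ∀ y, ok y → famCov J y v ≤ 1 → ∀ s ∉ D, famCov J y s ≤ 1 := by
        intro y hy hyv s hs
        by_cases hsv : s = v
        · exact hsv ▸ hyv
        · exact hy.2 s (by simp [hs, hsv])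
      obtain ⟨t, ht0, ⟨y₀, hy₀, hy₀v, hy₀t⟩, htmin⟩ : ∃ t : ℤ, 0 ≤ t ∧
          (∃ y, ok y ∧ famCov J y v = 0 ∧ L - w y = t) ∧
          ∀ y, ok y → famCov J y v = 0 → t ≤ L - w y := by
        have hne : ∃ n : ℕ, ∃ y, ok y ∧ famCov J y v = 0 ∧ L - w y = n := by
          have h0 : ∀ s, famCov J (0 : Λ → ℕ) s = 0 := fun s => by simp [famCov, famVal]
          have hok : ok 0 := ⟨fun X hX => absurd rfl hX, fun s _ => by rw [h0]; exact zero_le_one⟩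
          have := hH' 0 hok.1 (hoff 0 hok (by rw [h0]; exact zero_le_one))
          exact ⟨(L - w 0).toNat, 0, hok, h0 v, by omega⟩
        refine ⟨Nat.find hne, by positivity, Nat.find_spec hne, fun y hy hyv => ?_⟩
        have h1 := hH' y hy.1 (hoff y hy (by rw [hyv]; exact zero_le_one))
        have h2 := Nat.find_min' hne (m := (L - w y).toNat) ⟨y, hy, hyv, by omega⟩
        omega
      have hconc : ∀ j : ℕ, ∀ y, ok y → famCov J y v = j → w y ≤ L + ((j : ℤ) - 1) * t := by
        intro j
        induction j using Nat.strong_induction_on with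
        | _ j ihj =>
        intro y hy hyv
        rcases Nat.lt_or_ge j 2 with hj | hj
        · interval_cases j
          · have := htmin y hy (by simpa using hyv)
            push_cast
            linarith
          · have := hH' y hy.1 (hoff y hy (by rw [hyv]; norm_num))
            push_cast
            linarith
        · obtain ⟨y₁, y₂, hG₁, hG₂, hcov, hbal, hval⟩ := hsys.exists_split (y := y₀ + y)
            (fun X hX => by
              by_cases h0 : y₀ X = 0
              · exact hy.1 X (by simpa [h0] using hX)
              · exact hy₀.1 X h0)
          have hcadd : ∀ s, famCov J y₁ s + famCov J y₂ s = famCov J y₀ s + famCov J y s :=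
            fun s => (hcov s).trans (famVal_add _ _ _)
          have hok : ok y₁ ∧ ok y₂ := by
            refine ⟨⟨hG₁, fun s hs => ?_⟩, ⟨hG₂, fun s hs => ?_⟩⟩ <;>
            · have h1 := hcadd s
              have h2 := abs_le.1 (hbal s)
              have h3 := hy₀.2 s hs
              have h4 := hy.2 s hs
              omega
          have hv1 := hcadd v
          have hv2 := abs_le.1 (hbal v)
          rw [hy₀v, hyv] at hv1
          have e1 := ihj (famCov J y₁ v).toNat (by omega) y₁ hok.1 (by omega)
          have e2 := ihj (famCov J y₂ v).toNat (by omega) y₂ hok.2 (by omega)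
          rw [Int.toNat_of_nonneg (famCov_nonneg _ _ _)] at e1 e2
          have e3 : w y₀ + w y ≤ w y₁ + w y₂ := by
            refine le_trans (le_of_eq (famVal_add _ _ _).symm) hval
          have e4 : famCov J y₂ v = j - famCov J y₁ v := by linarith
          rw [e4] at e2
          nlinarith
      refine ⟨Function.update m v t, fun s => ?_, fun y hy hcov => ?_⟩
      · by_cases hs : s = v
        · subst hs
          simpa using ht0
        · simpa [hs] using hm s
      · have h1 := hconc (famCov J y v).toNat y ⟨hy, hcov⟩
          (Int.toNat_of_nonneg (famCov_nonneg _ _ _)).symm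
        rw [Int.toNat_of_nonneg (famCov_nonneg _ _ _), hw, hL] at h1
        rw [sum_insert hv, sum_insert hv, Function.update_self]
        have hne : ∀ s ∈ D, Function.update m v t s = m s := fun s hs =>
          Function.update_of_ne (ne_of_mem_of_not_mem hs hv) _ _
        rw [sum_congr rfl fun s hs => by rw [hne s hs], sum_congr rfl hne]
        linarith
  obtain ⟨m, hm, hH⟩ := key univ
  refine ⟨m, hm, ?_, fun X hX => ?_⟩
  · have := hH 0 (fun X hX => absurd rfl hX) (fun s hs => absurd (mem_univ s) hs)
    simpa [famVal, famCov] using this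
  · by_contra hlt
    have h1 := hH ((ℓ + 1) • Pi.single X 1) (fun Y hY => by
        by_cases hYX : Y = X
        · exact hYX ▸ hX
        · simp [hYX] at hY) (fun s hs => absurd (mem_univ s) hs)
    have h2 : 0 ≤ ∑ s, m s := sum_nonneg fun s _ => hm s
    simp only [famCov, famVal_nsmul, famVal_single] at h1
    have h3 : ∑ s, m s * (((ℓ + 1 : ℕ) : ℤ) * if s ∈ J X then 1 else 0) =
        ((ℓ + 1 : ℕ) : ℤ) * ∑ s ∈ J X, m s := by
      rw [mul_sum, ← sum_filter_add_sum_filter_not univ (· ∈ J X)]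
      rw [sum_eq_zero (s := univ.filter (· ∉ J X)), add_zero, filter_mem_eq_inter, univ_inter]
      · refine sum_congr rfl fun s hs => ?_
        rw [if_pos hs]
        ring
      · intro s hs
        simp [(mem_filter.1 hs).2]
    rw [h3] at h1
    push_cast at h1
    push Not at hlt
    nlinarith [Int.natCast_nonneg ℓ]

end Uncrossing

section Petals

variable {V α σ : Type} [Fintype V] [DecidableEq V] [Fintype α] [DecidableEq α]
  [Fintype σ] [DecidableEq σ] {tl hd : α → V}

theorem mem_PReach {X : Finset V} {u : V} :
    u ∈ PReach tl hd X ↔ ∃ w ∈ X, DReach tl hd univ u w := by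
  simp [PReach]

theorem mem_SX {loc : σ → V} {X : Finset V} {s : σ} : s ∈ SX loc X ↔ loc s ∈ X := by
  simp [SX]

theorem SX_mono (loc : σ → V) {X Y : Finset V} (h : X ⊆ Y) : SX loc X ⊆ SX loc Y :=
  fun _ hs => mem_SX.2 (h (mem_SX.1 hs))

theorem dreach_arc (a : α) : DReach tl hd univ (tl a) (hd a) :=
  Relation.ReflTransGen.single ⟨a, mem_univ a, rfl, rfl⟩

theorem subset_PReach (X : Finset V) : X ⊆ PReach tl hd X :=
  fun u hu => mem_PReach.2 ⟨u, hu, Relation.ReflTransGen.refl⟩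

theorem mem_PReach_of_reach {X : Finset V} {u w : V} (h : DReach tl hd univ u w)
    (hw : w ∈ PReach tl hd X) : u ∈ PReach tl hd X := by
  obtain ⟨x, hx, hr⟩ := mem_PReach.1 hw
  exact mem_PReach.2 ⟨x, hx, Relation.ReflTransGen.trans h hr⟩

theorem PReach_eq_of_subset {C K : Finset V} (hC : IsAtomOf tl hd C) (hK : K.Nonempty)
    (hKC : K ⊆ C) : PReach tl hd K = PReach tl hd C := by
  obtain ⟨k, hk⟩ := hK
  ext u
  constructor
  · intro hu
    obtain ⟨w, hw, hr⟩ := mem_PReach.1 hu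
    exact mem_PReach.2 ⟨w, hKC hw, hr⟩
  · intro hu
    obtain ⟨w, hw, hr⟩ := mem_PReach.1 hu
    exact mem_PReach.2 ⟨k, hk, Relation.ReflTransGen.trans hr (hC.1.2 w hw k (hKC hk))⟩

theorem IsAtomOf.eq_of_reach {C₁ C₂ : Finset V} (h₁ : IsAtomOf tl hd C₁)
    (h₂ : IsAtomOf tl hd C₂) {u w : V} (hu : u ∈ C₁) (hw : w ∈ C₂) (huw : DReach tl hd univ u w)
    (hwu : DReach tl hd univ w u) : C₁ = C₂ := by
  have hsub : IsSubatom tl hd (C₁ ∪ C₂) := by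
    have hto : ∀ x ∈ C₁ ∪ C₂, DReach tl hd univ x u := fun x hx =>
      (mem_union.1 hx).elim (fun h => h₁.1.2 x h u hu)
        fun h => Relation.ReflTransGen.trans (h₂.1.2 x h w hw) hwu
    have hfrom : ∀ x ∈ C₁ ∪ C₂, DReach tl hd univ u x := fun x hx =>
      (mem_union.1 hx).elim (fun h => h₁.1.2 u hu x h)
        fun h => Relation.ReflTransGen.trans huw (h₂.1.2 w hw x h)
    exact ⟨⟨u, mem_union_left _ hu⟩, fun x hx y hy =>
      Relation.ReflTransGen.trans (hto x hx) (hfrom y hy)⟩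
  exact (h₁.2 _ hsub subset_union_left).symm.trans (h₂.2 _ hsub subset_union_right)

/-- `O` is a petal with atom `C`. -/
def PetalOf (tl hd : α → V) (C O : Finset V) : Prop :=
  IsAtomOf tl hd C ∧ (O ∩ C).Nonempty ∧ O ⊆ PReach tl hd C ∧ inDegB tl hd univ (O \ C) = 0

theorem inDegB_eq_zero_iff {X : Finset V} :
    inDegB tl hd univ X = 0 ↔ ∀ a, hd a ∈ X → tl a ∈ X := by
  rw [inDegB, card_eq_zero, filter_eq_empty_iff]
  refine forall_congr' fun a => ?_
  simp only [mem_univ, true_implies, not_and]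
  tauto

theorem PetalOf.tl_mem {C O : Finset V} (h : PetalOf tl hd C O) {a : α} (ha : hd a ∈ O)
    (hC : hd a ∉ C) : tl a ∈ O ∧ tl a ∉ C :=
  mem_sdiff.1 (inDegB_eq_zero_iff.1 h.2.2.2 a (mem_sdiff.2 ⟨ha, hC⟩))

theorem PetalOf.unique {C₁ C₂ O : Finset V} (h₁ : PetalOf tl hd C₁ O)
    (h₂ : PetalOf tl hd C₂ O) : C₁ = C₂ := by
  obtain ⟨z₁, hz₁⟩ := h₁.2.1
  obtain ⟨z₂, hz₂⟩ := h₂.2.1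
  rw [mem_inter] at hz₁ hz₂
  obtain ⟨c₂, hc₂, hr₂⟩ := mem_PReach.1 (h₂.2.2.1 hz₁.1)
  obtain ⟨c₁, hc₁, hr₁⟩ := mem_PReach.1 (h₁.2.2.1 hz₂.1)
  exact h₁.1.eq_of_reach h₂.1 hz₁.2 hz₂.2
    (Relation.ReflTransGen.trans hr₂ (h₂.1.1.2 c₂ hc₂ z₂ hz₂.2))
    (Relation.ReflTransGen.trans hr₁ (h₁.1.1.2 c₁ hc₁ z₁ hz₁.2))

theorem petalOf_petalAtom {O : Finset V} (h : IsPetal tl hd O) :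
    PetalOf tl hd (petalAtom tl hd O) O := by
  rw [petalAtom, dif_pos h]
  exact h.choose_spec

theorem PetalOf.isPetal {C O : Finset V} (h : PetalOf tl hd C O) : IsPetal tl hd O := ⟨C, h⟩

theorem PetalOf.petalAtom_eq {C O : Finset V} (h : PetalOf tl hd C O) : petalAtom tl hd O = C :=
  (petalOf_petalAtom h.isPetal).unique h

theorem PetalOf.petalCore_eq {C O : Finset V} (h : PetalOf tl hd C O) :
    petalCore tl hd O = C ∩ O := by
  rw [petalCore, h.petalAtom_eq]

theorem PetalOf.bisetInDeg_eq {C O : Finset V} (h : PetalOf tl hd C O) :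
    bisetInDeg tl hd univ O (C ∩ O) = inDegB tl hd univ O := by
  unfold bisetInDeg inDegB
  congr 1
  refine filter_congr fun a _ => ⟨fun ⟨h1, h2⟩ => ⟨h1, (mem_inter.1 h2).2⟩, fun ⟨h1, h2⟩ =>
    ⟨h1, mem_inter.2 ⟨?_, h2⟩⟩⟩
  by_contra hC
  exact h1 (h.tl_mem h2 hC).1

theorem PetalOf.sup {C O₁ O₂ : Finset V} (h₁ : PetalOf tl hd C O₁) (h₂ : PetalOf tl hd C O₂) :
    PetalOf tl hd C (O₁ ∪ O₂) := by
  refine ⟨h₁.1, h₁.2.1.mono (inter_subset_inter_right subset_union_left),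
    union_subset h₁.2.2.1 h₂.2.2.1, inDegB_eq_zero_iff.2 fun a ha => ?_⟩
  obtain ⟨ha, hC⟩ := mem_sdiff.1 ha
  rcases mem_union.1 ha with ha | ha
  · exact mem_sdiff.2 ⟨mem_union_left _ (h₁.tl_mem ha hC).1, (h₁.tl_mem ha hC).2⟩
  · exact mem_sdiff.2 ⟨mem_union_right _ (h₂.tl_mem ha hC).1, (h₂.tl_mem ha hC).2⟩

theorem PetalOf.inf {C O₁ O₂ : Finset V} (h₁ : PetalOf tl hd C O₁) (h₂ : PetalOf tl hd C O₂)
    (hne : ((O₁ ∩ O₂) ∩ C).Nonempty) : PetalOf tl hd C (O₁ ∩ O₂) := by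
  refine ⟨h₁.1, hne, inter_subset_left.trans h₁.2.2.1, inDegB_eq_zero_iff.2 fun a ha => ?_⟩
  obtain ⟨ha, hC⟩ := mem_sdiff.1 ha
  obtain ⟨ha₁, ha₂⟩ := mem_inter.1 ha
  exact mem_sdiff.2 ⟨mem_inter.2 ⟨(h₁.tl_mem ha₁ hC).1, (h₂.tl_mem ha₂ hC).1⟩,
    (h₁.tl_mem ha₁ hC).2⟩

theorem inDegB_submod (X Y : Finset V) :
    inDegB tl hd univ (X ∪ Y) + inDegB tl hd univ (X ∩ Y) ≤
      inDegB tl hd univ X + inDegB tl hd univ Y := by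
  unfold inDegB
  simp only [card_filter]
  rw [← sum_add_distrib, ← sum_add_distrib]
  refine sum_le_sum fun a _ => ?_
  by_cases h1 : tl a ∈ X <;> by_cases h2 : tl a ∈ Y <;> by_cases h3 : hd a ∈ X <;>
    by_cases h4 : hd a ∈ Y <;> simp [h1, h2, h3, h4]

/-- Triples `(K, O, F)` where `O` is a petal with core `K`, and `F` is a set of roots located in
`O` containing all roots located outside the core. -/
def IsPetalTriple (tl hd : α → V) (loc : σ → V) (X : Finset V × Finset V × Finset σ) : Prop :=
  ∃ C, PetalOf tl hd C X.2.1 ∧ X.1 = C ∩ X.2.1 ∧ X.2.2 ⊆ SX loc X.2.1 ∧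
    SX loc (X.2.1 \ C) ⊆ X.2.2

theorem indicator_diff_modular {p q a b : Prop} (hp : p → a) (hq : q → b)
    [Decidable (a ∧ ¬p)] [Decidable (b ∧ ¬q)] [Decidable ((a ∨ b) ∧ ¬(p ∨ q))]
    [Decidable ((a ∧ b) ∧ ¬(p ∧ q))] :
    (if a ∧ ¬p then (1 : ℤ) else 0) + (if b ∧ ¬q then (1 : ℤ) else 0) =
      (if (a ∨ b) ∧ ¬(p ∨ q) then (1 : ℤ) else 0) +
        (if (a ∧ b) ∧ ¬(p ∧ q) then (1 : ℤ) else 0) := by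
  by_cases h1 : p <;> by_cases h2 : q <;> by_cases h3 : a <;> by_cases h4 : b <;>
    first
    | exact absurd (hp h1) h3
    | exact absurd (hq h2) h4
    | simp [h1, h2, h3, h4]

theorem crossingSystem_petalTriple (loc : σ → V) (M : RankFn σ) :
    CrossingSystem (IsPetalTriple tl hd loc) (fun X => X.1) (fun X => SX loc X.2.1 \ X.2.2)
      (fun X => (M.r (SX loc (PReach tl hd X.1)) : ℤ) - M.r X.2.2 - inDegB tl hd univ X.2.1)
      (fun X => X.1.card + X.2.1.card + X.2.2.card) := by
  have hatom : ∀ X Y : Finset V × Finset V × Finset σ, IsPetalTriple tl hd loc X →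
      IsPetalTriple tl hd loc Y → (X.1 ∩ Y.1).Nonempty →
      ∃ C, (PetalOf tl hd C X.2.1 ∧ X.1 = C ∩ X.2.1 ∧ X.2.2 ⊆ SX loc X.2.1 ∧
        SX loc (X.2.1 \ C) ⊆ X.2.2) ∧ (PetalOf tl hd C Y.2.1 ∧ Y.1 = C ∩ Y.2.1 ∧
        Y.2.2 ⊆ SX loc Y.2.1 ∧ SX loc (Y.2.1 \ C) ⊆ Y.2.2) := by
    rintro X Y ⟨C, hX⟩ ⟨C', hY⟩ ⟨u, hu⟩
    have hu₁ := (mem_inter.1 hu).1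
    have hu₂ := (mem_inter.1 hu).2
    rw [hX.2.1] at hu₁
    rw [hY.2.1] at hu₂
    have : C = C' := hX.1.1.eq_of_reach hY.1.1 (mem_inter.1 hu₁).1 (mem_inter.1 hu₂).1
      Relation.ReflTransGen.refl Relation.ReflTransGen.refl
    subst this
    exact ⟨C, hX, hY⟩
  have hclosed : ∀ X Y : Finset V × Finset V × Finset σ, IsPetalTriple tl hd loc X →
      IsPetalTriple tl hd loc Y → (X.1 ∩ Y.1).Nonempty →
      IsPetalTriple tl hd loc (X ⊔ Y) ∧ IsPetalTriple tl hd loc (X ⊓ Y) := by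
    intro X Y hX hY hXY
    obtain ⟨C, ⟨hX₁, hX₂, hX₃, hX₄⟩, hY₁, hY₂, hY₃, hY₄⟩ := hatom X Y hX hY hXY
    refine ⟨⟨C, hX₁.sup hY₁, ?_, ?_, ?_⟩, ⟨C, hX₁.inf hY₁ ?_, ?_, ?_, ?_⟩⟩
    · change X.1 ∪ Y.1 = C ∩ (X.2.1 ∪ Y.2.1)
      rw [hX₂, hY₂, inter_union_distrib_left]
    · refine union_subset (hX₃.trans (SX_mono loc subset_union_left))
        (hY₃.trans (SX_mono loc subset_union_right))
    · intro s hs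
      obtain ⟨hs, hC⟩ := mem_sdiff.1 (mem_SX.1 hs)
      rcases mem_union.1 hs with hs | hs
      · exact mem_union_left _ (hX₄ (mem_SX.2 (mem_sdiff.2 ⟨hs, hC⟩)))
      · exact mem_union_right _ (hY₄ (mem_SX.2 (mem_sdiff.2 ⟨hs, hC⟩)))
    · refine hXY.mono ?_
      rw [hX₂, hY₂]
      intro u hu
      simp only [mem_inter] at hu ⊢
      tauto
    · change X.1 ∩ Y.1 = C ∩ (X.2.1 ∩ Y.2.1)
      rw [hX₂, hY₂]
      ext u
      simp only [mem_inter]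
      tauto
    · intro s hs
      obtain ⟨h₁, h₂⟩ := mem_inter.1 hs
      exact mem_SX.2 (mem_inter.2 ⟨mem_SX.1 (hX₃ h₁), mem_SX.1 (hY₃ h₂)⟩)
    · intro s hs
      obtain ⟨hs, hC⟩ := mem_sdiff.1 (mem_SX.1 hs)
      obtain ⟨h₁, h₂⟩ := mem_inter.1 hs
      exact mem_inter.2 ⟨hX₄ (mem_SX.2 (mem_sdiff.2 ⟨h₁, hC⟩)),
        hY₄ (mem_SX.2 (mem_sdiff.2 ⟨h₂, hC⟩))⟩
  refine ⟨hclosed, ?_, ?_, ?_, fun X Y h => h.1, ?_, ?_, ?_, ?_⟩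
  · intro X Y hX hY hXY
    obtain ⟨C, ⟨hX₁, hX₂, hX₃, hX₄⟩, hY₁, hY₂, hY₃, hY₄⟩ := hatom X Y hX hY hXY
    have hP : ∀ K : Finset V, K.Nonempty → K ⊆ C → PReach tl hd K = PReach tl hd C :=
      fun K hK hKC => PReach_eq_of_subset hX₁.1 hK hKC
    have hXC : X.1 ⊆ C := hX₂ ▸ inter_subset_left
    have hYC : Y.1 ⊆ C := hY₂ ▸ inter_subset_left
    change _ ≤ (M.r (SX loc (PReach tl hd (X.1 ∪ Y.1))) : ℤ) - M.r (X.2.2 ∪ Y.2.2) -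
      inDegB tl hd univ (X.2.1 ∪ Y.2.1) + ((M.r (SX loc (PReach tl hd (X.1 ∩ Y.1))) : ℤ) -
      M.r (X.2.2 ∩ Y.2.2) - inDegB tl hd univ (X.2.1 ∩ Y.2.1))
    rw [hP X.1 (hXY.mono inter_subset_left) hXC, hP Y.1 (hXY.mono inter_subset_right) hYC,
      hP _ ((hXY.mono inter_subset_left).mono subset_union_left) (union_subset hXC hYC),
      hP _ hXY (inter_subset_left.trans hXC)]
    have h1 := M.r_submod X.2.2 Y.2.2
    have h2 := inDegB_submod (tl := tl) (hd := hd) X.2.1 Y.2.1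
    zify at h1 h2
    linarith
  · intro X Y hX hY hXY s
    obtain ⟨_, -, -, hX₃, -⟩ := hX
    obtain ⟨_, -, -, hY₃, -⟩ := hY
    change _ = (if s ∈ SX loc (X.2.1 ∪ Y.2.1) \ (X.2.2 ∪ Y.2.2) then (1 : ℤ) else 0) +
      (if s ∈ SX loc (X.2.1 ∩ Y.2.1) \ (X.2.2 ∩ Y.2.2) then (1 : ℤ) else 0)
    simp only [mem_sdiff, mem_SX, mem_union, mem_inter]
    have hX' : s ∈ X.2.2 → loc s ∈ X.2.1 := fun h => mem_SX.1 (hX₃ h)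
    have hY' : s ∈ Y.2.2 → loc s ∈ Y.2.1 := fun h => mem_SX.1 (hY₃ h)
    exact indicator_diff_modular hX' hY'
  · rintro X ⟨C, hC, hX, -⟩
    rw [hX, inter_comm]
    exact hC.2.1
  · intro X Y Z _ _ _ hXY hYZ s hsX hsZ
    rw [mem_sdiff, mem_SX] at hsX hsZ ⊢
    exact ⟨hXY.2.1 hsX.1, fun h => hsZ.2 (hYZ.2.2 h)⟩
  · rintro X Y ⟨C, hC, hX, -, hX₄⟩ ⟨C', hC', hY, -, hY₄⟩ s hsX hsY
    rw [mem_sdiff, mem_SX] at hsX hsY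
    refine ⟨loc s, mem_inter.2 ⟨?_, ?_⟩⟩
    · rw [hX]
      refine mem_inter.2 ⟨?_, hsX.1⟩
      by_contra hn
      exact hsX.2 (hX₄ (mem_SX.2 (mem_sdiff.2 ⟨hsX.1, hn⟩)))
    · rw [hY]
      refine mem_inter.2 ⟨?_, hsY.1⟩
      by_contra hn
      exact hsY.2 (hY₄ (mem_SX.2 (mem_sdiff.2 ⟨hsY.1, hn⟩)))
  · intro X Y hlt
    have h1 := card_le_card hlt.le.1
    have h2 := card_le_card hlt.le.2.1
    have h3 := card_le_card hlt.le.2.2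
    by_contra hge
    dsimp only at hge
    exact hlt.ne (Prod.ext (eq_of_subset_of_card_le hlt.le.1 (by omega))
      (Prod.ext (eq_of_subset_of_card_le hlt.le.2.1 (by omega))
        (eq_of_subset_of_card_le hlt.le.2.2 (by omega))))
  · intro X Y
    change (X.1 ∪ Y.1).card + (X.2.1 ∪ Y.2.1).card + (X.2.2 ∪ Y.2.2).card +
      ((X.1 ∩ Y.1).card + (X.2.1 ∩ Y.2.1).card + (X.2.2 ∩ Y.2.2).card) = _
    have h1 := card_union_add_card_inter X.1 Y.1
    have h2 := card_union_add_card_inter X.2.1 Y.2.1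
    have h3 := card_union_add_card_inter X.2.2 Y.2.2
    omega

/-- The condition on a set of roots `T` under which `T` is the root set of a packing. -/
def RootsSuffice (tl hd : α → V) (loc : σ → V) (M : RankFn σ) (T : Finset σ) : Prop :=
  ∀ C O, PetalOf tl hd C O → M.r (SX loc (PReach tl hd C)) ≤
    inDegB tl hd univ O + M.r ((T ∩ SX loc (O ∩ C)) ∪ SX loc (O \ C))

theorem exists_rootsSuffice (loc : σ → V) (M : RankFn σ) (ℓ' : ℕ)
    (hpetal : ∀ C O, PetalOf tl hd C O →
      M.r (SX loc (PReach tl hd C)) ≤ M.r (SX loc O) + inDegB tl hd univ O)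
    (hfam : ∀ P : Finset (Finset V × Finset V),
      (∀ X ∈ P, IsPetal tl hd X.1 ∧ X.2.Nonempty ∧ X.2 ⊆ petalCore tl hd X.1) →
      (∀ X ∈ P, ∀ Y ∈ P, X ≠ Y → (petalCore tl hd X.1 ∩ petalCore tl hd Y.1).Nonempty →
        X.1 ⊆ Y.1 \ Y.2 ∨ Y.1 ⊆ X.1 \ X.2) →
      ∑ X ∈ P, ((M.r (SX loc (PReach tl hd X.2)) : ℤ)
        - M.r (SX loc (X.1 \ X.2)) - inDegB tl hd univ X.1) ≤ (ℓ' : ℤ)) :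
    ∃ T : Finset σ, T.card ≤ ℓ' ∧ RootsSuffice tl hd loc M T := by
  have hsys := crossingSystem_petalTriple (tl := tl) (hd := hd) loc M
  have hempty : ∀ X : Finset V × Finset V × Finset σ, IsPetalTriple tl hd loc X →
      SX loc X.2.1 ⊆ X.2.2 → (M.r (SX loc (PReach tl hd X.1)) : ℤ) - M.r X.2.2 -
        inDegB tl hd univ X.2.1 ≤ 0 := by
    rintro X ⟨C, hC, hX, -, -⟩ hsub
    have h1 := hpetal C X.2.1 hC
    have h2 := M.r_mono hsub
    rw [hX, PReach_eq_of_subset hC.1 (by rw [inter_comm]; exact hC.2.1) inter_subset_left]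
    omega
  let inner : Finset V × Finset V × Finset σ → Finset V := fun X =>
    X.2.1.filter fun v => ¬ SX loc {v} ⊆ X.2.2
  have hwall : ∀ X : Finset V × Finset V × Finset σ, SX loc (X.2.1 \ inner X) ⊆ X.2.2 := by
    intro X s hs
    obtain ⟨h1, h2⟩ := mem_sdiff.1 (mem_SX.1 hs)
    have h3 : SX loc {loc s} ⊆ X.2.2 := by
      by_contra h3
      exact h2 (mem_filter.2 ⟨h1, h3⟩)
    exact h3 (mem_SX.2 (mem_singleton_self _))
  have hinner : ∀ X, IsPetalTriple tl hd loc X → inner X ⊆ X.1 := by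
    rintro X ⟨C, hC, hX, -, hX₄⟩ v hv
    obtain ⟨hv, hvn⟩ := mem_filter.1 hv
    rw [hX]
    refine mem_inter.2 ⟨?_, hv⟩
    by_contra hvC
    refine hvn fun s hs => hX₄ (mem_SX.2 ?_)
    rw [mem_singleton.1 (mem_SX.1 hs)]
    exact mem_sdiff.2 ⟨hv, hvC⟩
  obtain ⟨m, hm0, hmsum, hmcov⟩ := hsys.exists_cover ℓ'
    (fun X hX hJ => hempty X hX (sdiff_eq_empty_iff_subset.1 hJ)) (by
      intro R hRG hun hdisj
      have hlam : ∀ X ∈ R, ∀ Y ∈ R, X ≠ Y → X ≤ Y → X.2.1 ⊆ Y.2.1 \ inner Y := by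
        intro X hX Y hY hne hle v hv
        refine mem_sdiff.2 ⟨hle.2.1 hv, fun hv' => ?_⟩
        apply (mem_filter.1 hv').2
        intro s hs
        have hsv := mem_singleton.1 (mem_SX.1 hs)
        by_contra hsY
        exact disjoint_left.1 (hdisj X hX Y hY hne)
          (mem_sdiff.2 ⟨mem_SX.2 (hsv ▸ hv), fun h => hsY (hle.2.2 h)⟩)
          (mem_sdiff.2 ⟨mem_SX.2 (hsv ▸ hle.2.1 hv), hsY⟩)
      have hcore : ∀ X ∈ R, petalCore tl hd X.2.1 = X.1 := by
        intro X hX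
        obtain ⟨C, hC, hX', -⟩ := hRG X hX
        rw [hC.petalCore_eq, hX']
      have hcomp : ∀ X ∈ R, ∀ Y ∈ R, X ≠ Y → (X.1 ∩ Y.1).Nonempty →
          X.2.1 ⊆ Y.2.1 \ inner Y ∨ Y.2.1 ⊆ X.2.1 \ inner X := fun X hX Y hY hne hXY =>
        (hun X Y hX hY hXY).imp (hlam X hX Y hY hne) (hlam Y hY X hX hne.symm)
      set R' := R.filter fun X => (inner X).Nonempty with hR'
      have hinj : Set.InjOn (fun X => (X.2.1, inner X)) (R' : Set _) := by
        intro X hX Y hY hXY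
        obtain ⟨hX, v, hv⟩ := mem_filter.1 (mem_coe.1 hX)
        obtain ⟨hY, w, hw⟩ := mem_filter.1 (mem_coe.1 hY)
        have hXY' : (X.2.1, inner X) = (Y.2.1, inner Y) := hXY
        obtain ⟨e1, e2⟩ := Prod.mk.inj hXY'
        by_contra hne
        have hc : X.1 = Y.1 := by rw [← hcore X hX, ← hcore Y hY, e1]
        rcases hcomp X hX Y hY hne (by
          rw [hc, inter_self, ← hc]
          exact hsys.core_nonempty X (hRG X hX)) with h | h
        · have hvO := (mem_filter.1 hv).1
          exact (mem_sdiff.1 (h hvO)).2 (e2 ▸ hv)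
        · have hwO := (mem_filter.1 hw).1
          exact (mem_sdiff.1 (h hwO)).2 (e2 ▸ hw)
      have h1 := hfam (R'.image fun X => (X.2.1, inner X)) (by
        intro P hP
        obtain ⟨X, hX, rfl⟩ := mem_image.1 hP
        obtain ⟨hX, hne⟩ := mem_filter.1 hX
        obtain ⟨C, hC, -⟩ := hRG X hX
        exact ⟨hC.isPetal, hne, (hcore X hX).symm ▸ hinner X (hRG X hX)⟩) (by
        intro P hP P' hP' hne hPP
        obtain ⟨X, hX, rfl⟩ := mem_image.1 hP
        obtain ⟨Y, hY, rfl⟩ := mem_image.1 hP'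
        have hX := (mem_filter.1 hX).1
        have hY := (mem_filter.1 hY).1
        dsimp only at hPP
        rw [hcore X hX, hcore Y hY] at hPP
        exact hcomp X hX Y hY (fun h => hne (h ▸ rfl)) hPP)
      rw [sum_image hinj] at h1
      refine le_trans ?_ h1
      rw [hR', sum_filter]
      refine sum_le_sum fun X hX => ?_
      by_cases hne : (inner X).Nonempty
      · rw [if_pos hne]
        obtain ⟨C, hC, hX', -⟩ := hRG X hX
        have hKC : X.1 ⊆ C := hX' ▸ inter_subset_left
        have h2 := M.r_mono (hwall X)
        rw [PReach_eq_of_subset hC.1 hne ((hinner X (hRG X hX)).trans hKC),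
          PReach_eq_of_subset hC.1 (hsys.core_nonempty X (hRG X hX)) hKC]
        dsimp only
        omega
      · rw [if_neg hne]
        refine hempty X (hRG X hX) ?_
        have := hwall X
        rwa [not_nonempty_iff_eq_empty.1 hne, sdiff_empty] at this)
  refine ⟨univ.filter fun s => m s ≠ 0, ?_, ?_⟩
  · have : ((univ.filter fun s => m s ≠ 0).card : ℤ) ≤ ∑ s, m s := by
      rw [card_filter]
      push_cast
      refine sum_le_sum fun s _ => ?_
      have := hm0 s
      split <;> omega
    omega
  · intro C O hO
    have h1 := hmcov (C ∩ O, O, ((univ.filter fun s => m s ≠ 0) ∩ SX loc (O ∩ C)) ∪ SX loc (O \ C))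
      ⟨C, hO, rfl, union_subset (inter_subset_right.trans (SX_mono loc inter_subset_left))
        (SX_mono loc sdiff_subset), subset_union_right⟩
    dsimp only at h1
    rw [sum_eq_zero, PReach_eq_of_subset hO.1 (by rw [inter_comm]; exact hO.2.1)
      inter_subset_left] at h1
    · omega
    · intro s hs
      obtain ⟨hs1, hs2⟩ := mem_sdiff.1 hs
      by_contra hne
      refine hs2 ?_
      rw [mem_SX] at hs1
      by_cases hC : loc s ∈ C
      · exact mem_union_left _ (mem_inter.2 ⟨mem_filter.2 ⟨mem_univ _, hne⟩,
          mem_SX.2 (mem_inter.2 ⟨hs1, hC⟩)⟩)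
      · exact mem_union_right _ (mem_SX.2 (mem_sdiff.2 ⟨hs1, hC⟩))

end Petals

section Roots

variable {V α σ : Type} [Fintype V] [DecidableEq V] [Fintype α] [DecidableEq α]
  [Fintype σ] [DecidableEq σ] {tl hd : α → V}

theorem RankFn.r_eq_card_of_erase_ne (M : RankFn σ) {A : Finset σ}
    (h : ∀ s ∈ A, M.r (A.erase s) ≠ M.r A) : M.r A = A.card := by
  suffices ∀ B : Finset σ, B ⊆ A → M.r B = B.card from this A subset_rfl
  intro B
  induction B using Finset.induction_on with
  | empty => intro _; simpa using M.r_empty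
  | insert s B hs ih =>
    intro hB
    have hsA := hB (mem_insert_self s B)
    have hBA : B ⊆ A.erase s := fun t ht =>
      mem_erase.2 ⟨fun hts => hs (hts ▸ ht), hB (mem_insert_of_mem ht)⟩
    have hne : M.r (insert s B) ≠ M.r B := by
      intro heq
      have := M.r_insert_eq_of_subset hBA heq
      rw [insert_erase hsA] at this
      exact h s hsA this.symm
    have h1 := M.r_mono (subset_insert s B)
    have h2 := M.r_insert_le s B
    rw [card_insert_of_notMem hs, ← ih (hBA.trans (erase_subset s A))]
    omega

theorem sum_card_inter_SX (loc : σ → V) (T : Finset σ) :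
    ∑ v, (T ∩ SX loc {v}).card = T.card := by
  rw [card_eq_sum_card_fiberwise (f := loc) (t := univ) fun _ _ => mem_coe.2 (mem_univ _)]
  refine sum_congr rfl fun v _ => congrArg card ?_
  ext s
  simp [mem_SX]

theorem RootsSuffice.mono {loc : σ → V} {M : RankFn σ} {T T' : Finset σ}
    (h : RootsSuffice tl hd loc M T) (hT : T ⊆ T') : RootsSuffice tl hd loc M T' :=
  fun C O hO => (h C O hO).trans (Nat.add_le_add_left (M.r_mono
    (union_subset_union_left (inter_subset_inter_right hT))) _)

theorem RootsSuffice.erase {loc : σ → V} {M : RankFn σ} {T : Finset σ}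
    (h : RootsSuffice tl hd loc M T) {s : σ}
    (hs : M.r ((T ∩ SX loc {loc s}).erase s) = M.r (T ∩ SX loc {loc s})) :
    RootsSuffice tl hd loc M (T.erase s) := by
  intro C O hO
  refine (h C O hO).trans (Nat.add_le_add_left ?_ _)
  by_cases hsO : s ∈ T ∧ loc s ∈ O ∩ C
  · obtain ⟨hsT, hsO⟩ := hsO
    have hsub : (T ∩ SX loc {loc s}).erase s ⊆
        (T.erase s ∩ SX loc (O ∩ C)) ∪ SX loc (O \ C) := by
      intro t ht
      obtain ⟨hne, ht⟩ := mem_erase.1 ht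
      obtain ⟨htT, htl⟩ := mem_inter.1 ht
      refine mem_union_left _ (mem_inter.2 ⟨mem_erase.2 ⟨hne, htT⟩, mem_SX.2 ?_⟩)
      rw [mem_singleton.1 (mem_SX.1 htl)]
      exact hsO
    have hins := M.r_insert_eq_of_subset (s := s) hsub (by
      rw [insert_erase (mem_inter.2 ⟨hsT, mem_SX.2 (mem_singleton_self _)⟩), hs])
    rw [← hins]
    refine M.r_mono fun t ht => ?_
    rcases mem_union.1 ht with ht | ht
    · by_cases hts : t = s
      · exact mem_insert.2 (Or.inl hts)
      · exact mem_insert_of_mem (mem_union_left _ (mem_inter.2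
          ⟨mem_erase.2 ⟨hts, (mem_inter.1 ht).1⟩, (mem_inter.1 ht).2⟩))
    · exact mem_insert_of_mem (mem_union_right _ ht)
  · refine M.r_mono (union_subset_union_left fun t ht => ?_)
    obtain ⟨htT, htl⟩ := mem_inter.1 ht
    exact mem_inter.2 ⟨mem_erase.2 ⟨fun hts => hsO (hts ▸ ⟨htT, mem_SX.1 htl⟩), htT⟩, htl⟩

/-- At every vertex, the elements of `T` located there are independent. -/
def LocallyIndep (loc : σ → V) (M : RankFn σ) (T : Finset σ) : Prop :=
  ∀ v, M.r (T ∩ SX loc {v}) = (T ∩ SX loc {v}).card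

theorem RootsSuffice.exists_locallyIndep {loc : σ → V} {M : RankFn σ} {T : Finset σ}
    (h : RootsSuffice tl hd loc M T) :
    ∃ T', T'.card ≤ T.card ∧ RootsSuffice tl hd loc M T' ∧ LocallyIndep loc M T' := by
  obtain ⟨T', hT', hmin⟩ := exists_min_image
    (univ.filter fun T' : Finset σ => RootsSuffice tl hd loc M T') card
    ⟨T, mem_filter.2 ⟨mem_univ _, h⟩⟩
  have hT' := (mem_filter.1 hT').2
  refine ⟨T', hmin T (mem_filter.2 ⟨mem_univ _, h⟩), hT', fun v => ?_⟩
  refine M.r_eq_card_of_erase_ne fun s hs heq => ?_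
  obtain ⟨hsT, hsv⟩ := mem_inter.1 hs
  obtain rfl := mem_singleton.1 (mem_SX.1 hsv)
  have := hmin _ (mem_filter.2 ⟨mem_univ _, hT'.erase heq⟩)
  have := card_erase_lt_of_mem hsT
  omega

theorem RootsSuffice.exists_locallyIndep_card {loc : σ → V} {M : RankFn σ} {T : Finset σ}
    {ℓ ℓ' : ℕ} (h : RootsSuffice tl hd loc M T) (hT : T.card ≤ ℓ') (hℓ : ℓ ≤ ℓ')
    (hsum : ℓ ≤ ∑ v : V, M.r (SX loc {v})) :
    ∃ T', ℓ ≤ T'.card ∧ T'.card ≤ ℓ' ∧ RootsSuffice tl hd loc M T' ∧ LocallyIndep loc M T' := by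
  obtain ⟨T₀, hc₀, hs₀, hi₀⟩ := h.exists_locallyIndep
  obtain ⟨T', hT', hmax⟩ := exists_max_image
    (univ.filter fun T' : Finset σ => T'.card ≤ ℓ' ∧ RootsSuffice tl hd loc M T' ∧
      LocallyIndep loc M T') card ⟨T₀, mem_filter.2 ⟨mem_univ _, hc₀.trans hT, hs₀, hi₀⟩⟩
  obtain ⟨-, hc, hs, hi⟩ := mem_filter.1 hT'
  refine ⟨T', ?_, hc, hs, hi⟩
  by_contra! hlt
  obtain ⟨v, -, hv⟩ : ∃ v ∈ univ, (T' ∩ SX loc {v}).card < M.r (SX loc {v}) := by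
    refine exists_lt_of_sum_lt ?_
    rw [sum_card_inter_SX]
    omega
  obtain ⟨s, hsv, hsr⟩ : ∃ s ∈ SX loc {v},
      M.r (insert s (T' ∩ SX loc {v})) ≠ M.r (T' ∩ SX loc {v}) := by
    by_contra! hall
    have h1 := M.r_union_eq hall
    have h2 := M.r_mono (subset_union_right : SX loc {v} ⊆ (T' ∩ SX loc {v}) ∪ SX loc {v})
    rw [h1, hi v] at h2
    omega
  have hsT : s ∉ T' := fun hsT => hsr (by rw [insert_eq_of_mem (mem_inter.2 ⟨hsT, hsv⟩)])
  have hbig := hmax (insert s T') (mem_filter.2 ⟨mem_univ _, ?_, hs.mono (subset_insert s T'), ?_⟩)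
  · rw [card_insert_of_notMem hsT] at hbig
    omega
  · rw [card_insert_of_notMem hsT]
    omega
  · intro w
    by_cases hwv : w = v
    · subst hwv
      rw [insert_inter_of_mem hsv, card_insert_of_notMem (fun hm => hsT (mem_inter.1 hm).1),
        ← hi w]
      have h1 := M.r_mono (subset_insert s (T' ∩ SX loc {w}))
      have h2 := M.r_insert_le s (T' ∩ SX loc {w})
      omega
    · rw [insert_inter_of_notMem]
      · exact hi w
      · intro hsw
        exact hwv ((mem_singleton.1 (mem_SX.1 hsw)).symm.trans (mem_singleton.1 (mem_SX.1 hsv)))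

end Roots

section Packing

variable {V α σ : Type} [Fintype V] [DecidableEq V] [Fintype α] [DecidableEq α]
  [Fintype σ] [DecidableEq σ] {tl hd : α → V}

/-- A partial packing that is complete on the set `W`, which no arc enters, and trivial
outside `W`. -/
structure CompleteOn (tl hd : α → V) (loc : σ → V) (M : RankFn σ) (T : Finset σ) (W : Finset V)
    (Q : V → Finset σ) (B : Finset α) (F : σ → Finset α) : Prop where
  packing : PartialPacking tl hd loc T Q B F
  closed : ∀ a, hd a ∈ W → tl a ∈ W
  basis : ∀ v ∈ W, IsBasisOf M.r (Q v) (SX loc (PReach tl hd {v}))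
  trivial : ∀ v ∉ W, Q v = T ∩ SX loc {v}
  unused : ∀ a, hd a ∉ W → a ∈ B

theorem completeOn_empty (loc : σ → V) (M : RankFn σ) (T : Finset σ) :
    CompleteOn tl hd loc M T ∅ (fun v => T ∩ SX loc {v}) univ (fun _ => ∅) where
  packing :=
    { arbor := fun s hs => by
        have : (univ.filter fun v => s ∈ T ∩ SX loc {v}) = {loc s} := by
          ext v
          simp [mem_SX, hs, eq_comm]
        rw [this]
        refine ⟨subset_rfl, by simp, by simp, fun w hw hn => absurd hw hn, fun w hw =>
          ⟨w, hw, Relation.ReflTransGen.refl⟩⟩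
      subset := fun v => inter_subset_left
      disjoint := by simp
      unused := by simp }
  closed := by simp
  basis := by simp
  trivial := by simp
  unused := by simp

theorem CompleteOn.mem_of_reach {loc : σ → V} {M : RankFn σ} {T : Finset σ} {W : Finset V}
    {Q : V → Finset σ} {B : Finset α} {F : σ → Finset α} (h : CompleteOn tl hd loc M T W Q B F)
    {u w : V} (huw : DReach tl hd univ u w) (hw : w ∈ W) : u ∈ W := by
  induction huw using Relation.ReflTransGen.head_induction_on with
  | refl => exact hw
  | head hstep _ ih =>
    obtain ⟨a, -, rfl, rfl⟩ := hstep
    exact h.closed a ih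

theorem isAtomOf_class (v : V) : IsAtomOf tl hd
    (univ.filter fun w => DReach tl hd univ v w ∧ DReach tl hd univ w v) := by
  refine ⟨⟨⟨v, mem_filter.2 ⟨mem_univ _, Relation.ReflTransGen.refl,
    Relation.ReflTransGen.refl⟩⟩, fun u hu w hw => ?_⟩,
    fun C' hC' hsub => subset_antisymm (fun u hu => ?_) hsub⟩
  · exact Relation.ReflTransGen.trans (mem_filter.1 hu).2.2 (mem_filter.1 hw).2.1
  · have hv : v ∈ C' := hsub (mem_filter.2 ⟨mem_univ _,
      Relation.ReflTransGen.refl, Relation.ReflTransGen.refl⟩)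
    exact mem_filter.2 ⟨mem_univ _, hC'.2 v hv u hu, hC'.2 u hu v hv⟩

theorem CompleteOn.cut {loc : σ → V} {M : RankFn σ} {T : Finset σ} {W : Finset V}
    {Q : V → Finset σ} {B : Finset α} {F : σ → Finset α} (h : CompleteOn tl hd loc M T W Q B F)
    (hT : RootsSuffice tl hd loc M T) {C : Finset V} (hC : IsAtomOf tl hd C)
    (hCW : ∀ u ∈ C, u ∉ W) (hNW : ∀ u ∈ PReach tl hd C, u ∉ C → u ∈ W) (X : Finset V)
    (hX : (X ∩ C).Nonempty) :
    M.r (SX loc (PReach tl hd C)) ≤ inDegOn tl hd B C X + M.r (X.biUnion Q) := by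
  set R := PReach tl hd ((X ∩ PReach tl hd C) \ C) with hR
  have hRC : ∀ u ∈ R, u ∉ C := by
    intro u hu huC
    obtain ⟨w, hw, huw⟩ := mem_PReach.1 hu
    obtain ⟨hw, hwC⟩ := mem_sdiff.1 hw
    exact hCW u huC (h.mem_of_reach huw (hNW w (mem_inter.1 hw).2 hwC))
  have hRN : R ⊆ PReach tl hd C := by
    intro u hu
    obtain ⟨w, hw, huw⟩ := mem_PReach.1 hu
    exact mem_PReach_of_reach huw (mem_inter.1 (mem_sdiff.1 hw).1).2
  have hRtl : ∀ a, hd a ∈ R → tl a ∈ R := fun a ha => mem_PReach_of_reach (dreach_arc a) ha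
  have hO : PetalOf tl hd C ((X ∩ C) ∪ R) := by
    refine ⟨hC, ?_, union_subset (inter_subset_right.trans (subset_PReach C)) hRN,
      inDegB_eq_zero_iff.2 fun a ha => ?_⟩
    · obtain ⟨x, hx⟩ := hX
      exact ⟨x, mem_inter.2 ⟨mem_union_left _ hx, (mem_inter.1 hx).2⟩⟩
    · obtain ⟨ha, haC⟩ := mem_sdiff.1 ha
      have haR : hd a ∈ R := (mem_union.1 ha).resolve_left fun h => haC (mem_inter.1 h).2
      exact mem_sdiff.2 ⟨mem_union_right _ (hRtl a haR), hRC _ (hRtl a haR)⟩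
  refine (hT C _ hO).trans (Nat.add_le_add ?_ ?_)
  · refine card_le_card fun a ha => ?_
    obtain ⟨-, hta, hha⟩ := mem_filter.1 ha
    rw [mem_union, not_or] at hta
    have haX : hd a ∈ X ∩ C := (mem_union.1 hha).resolve_right fun h => hta.2 (hRtl a h)
    obtain ⟨haX, haC⟩ := mem_inter.1 haX
    refine mem_filter.2 ⟨h.unused a (hCW _ haC), fun htX => ?_, haX, haC⟩
    by_cases htC : tl a ∈ C
    · exact hta.1 (mem_inter.2 ⟨htX, htC⟩)
    · exact hta.2 (subset_PReach _ (mem_sdiff.2 ⟨mem_inter.2 ⟨htX,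
        mem_PReach_of_reach (dreach_arc a) (subset_PReach C haC)⟩, htC⟩))
  · have hspan : ∀ s ∈ SX loc ((X ∩ C ∪ R) \ C),
        M.r (insert s (X.biUnion Q)) = M.r (X.biUnion Q) := by
      intro s hs
      obtain ⟨hs, hsC⟩ := mem_sdiff.1 (mem_SX.1 hs)
      have hsR : loc s ∈ R := (mem_union.1 hs).resolve_left fun h => hsC (mem_inter.1 h).2
      obtain ⟨w, hw, hsw⟩ := mem_PReach.1 hsR
      obtain ⟨hw, hwC⟩ := mem_sdiff.1 hw
      obtain ⟨hwX, hwN⟩ := mem_inter.1 hw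
      obtain ⟨hsub, -, hr⟩ := h.basis w (hNW w hwN hwC)
      refine M.r_insert_eq_of_subset (subset_biUnion_of_mem Q hwX)
        (le_antisymm ?_ (M.r_mono (subset_insert _ _)))
      rw [hr]
      exact M.r_mono (insert_subset (mem_SX.2 (mem_PReach.2 ⟨w, mem_singleton_self w, hsw⟩)) hsub)
    rw [← M.r_union_eq hspan]
    refine M.r_mono (union_subset_union_left fun s hs => ?_)
    obtain ⟨hsT, hs⟩ := mem_inter.1 hs
    obtain ⟨hs, hsC⟩ := mem_inter.1 (mem_SX.1 hs)
    have hsX : loc s ∈ X := (mem_union.1 hs).elim (fun h => (mem_inter.1 h).1)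
      fun h => absurd hsC (hRC _ h)
    refine mem_biUnion.2 ⟨loc s, hsX, ?_⟩
    rw [h.trivial _ (hCW _ hsC)]
    exact mem_inter.2 ⟨hsT, mem_SX.2 (mem_singleton_self _)⟩

theorem CompleteOn.extend {loc : σ → V} {M : RankFn σ} {T : Finset σ} {W : Finset V}
    {Q : V → Finset σ} {B : Finset α} {F : σ → Finset α} (h : CompleteOn tl hd loc M T W Q B F)
    (hT : RootsSuffice tl hd loc M T) (hi : LocallyIndep loc M T) (hW : W ≠ univ) :
    ∃ W' Q' B' F', W ⊂ W' ∧ CompleteOn tl hd loc M T W' Q' B' F' := by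
  obtain ⟨v, hv, hmin⟩ := exists_min_image Wᶜ (fun v => (PReach tl hd {v}).card)
    (by rwa [nonempty_iff_ne_empty, Ne, compl_eq_empty_iff])
  rw [mem_compl] at hv
  set C := univ.filter fun w => DReach tl hd univ v w ∧ DReach tl hd univ w v
  have hC : IsAtomOf tl hd C := isAtomOf_class v
  have hvC : v ∈ C := mem_filter.2 ⟨mem_univ _, Relation.ReflTransGen.refl,
    Relation.ReflTransGen.refl⟩
  have hCW : ∀ u ∈ C, u ∉ W := fun u hu huW => hv (h.mem_of_reach (mem_filter.1 hu).2.1 huW)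
  have hPC : ∀ u ∈ C, PReach tl hd {u} = PReach tl hd C := fun u hu =>
    PReach_eq_of_subset hC (singleton_nonempty u) (singleton_subset_iff.2 hu)
  have hNW : ∀ u ∈ PReach tl hd C, u ∉ C → u ∈ W := by
    intro u hu huC
    by_contra huW
    rw [← hPC v hvC] at hu
    obtain ⟨w, hw, huv⟩ := mem_PReach.1 hu
    obtain rfl := mem_singleton.1 hw
    refine (hmin u (mem_compl.2 huW)).not_gt (card_lt_card
      ⟨fun x hx => ?_, fun hsub => huC ?_⟩)
    · obtain ⟨y, hy, hxy⟩ := mem_PReach.1 hx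
      obtain rfl := mem_singleton.1 hy
      exact mem_PReach_of_reach hxy hu
    · obtain ⟨y, hy, hwy⟩ := mem_PReach.1 (hsub (subset_PReach _ (mem_singleton_self w)))
      obtain rfl := mem_singleton.1 hy
      exact mem_filter.2 ⟨mem_univ _, hwy, huv⟩
  obtain ⟨Q', B', F', hp, hb, hq, hB⟩ := h.packing.complete M (N := PReach tl hd C)
    (E := SX loc (PReach tl hd C)) (subset_PReach C)
    (fun a _ ha => mem_PReach_of_reach (dreach_arc a) (subset_PReach C ha)) (by
      intro u hu
      by_cases huC : u ∈ C
      · rw [h.trivial u (hCW u huC)]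
        exact inter_subset_right.trans (SX_mono loc (singleton_subset_iff.2 hu))
      · refine (h.basis u (hNW u hu huC)).1.trans (SX_mono loc fun x hx => ?_)
        obtain ⟨y, hy, hxy⟩ := mem_PReach.1 hx
        obtain rfl := mem_singleton.1 hy
        exact mem_PReach_of_reach hxy hu)
    (fun u hu => by rw [h.trivial u (hCW u hu)]; exact hi u)
    (h.cut hT hC hCW hNW)
  refine ⟨W ∪ C, Q', B', F', ⟨subset_union_left, fun hsub => hv (hsub (mem_union_right _ hvC))⟩,
    hp, fun a ha => ?_, fun u hu => ?_, fun u hu => ?_, fun a ha => ?_⟩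
  · rcases mem_union.1 ha with ha | ha
    · exact mem_union_left _ (h.closed a ha)
    · by_cases htC : tl a ∈ C
      · exact mem_union_right _ htC
      · exact mem_union_left _ (hNW _ (mem_PReach_of_reach (dreach_arc a)
          (subset_PReach C ha)) htC)
  · by_cases huC : u ∈ C
    · rw [hPC u huC]
      exact hb u huC
    · rw [hq u huC]
      exact h.basis u ((mem_union.1 hu).resolve_right huC)
  · rw [mem_union, not_or] at hu
    rw [hq u hu.2]
    exact h.trivial u hu.1
  · rw [mem_union, not_or] at ha
    exact hB a (h.unused a ha.1) ha.2

theorem exists_completeOn_univ {loc : σ → V} {M : RankFn σ} {T : Finset σ}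
    (hT : RootsSuffice tl hd loc M T) (hi : LocallyIndep loc M T) :
    ∃ Q B F, CompleteOn tl hd loc M T univ Q B F := by
  obtain ⟨W, hW, hmax⟩ := exists_max_image
    (univ.filter fun W : Finset V => ∃ Q B F, CompleteOn tl hd loc M T W Q B F) card
    ⟨∅, mem_filter.2 ⟨mem_univ _, _, _, _, completeOn_empty loc M T⟩⟩
  obtain ⟨-, Q, B, F, h⟩ := mem_filter.1 hW
  by_cases hWu : W = univ
  · exact ⟨Q, B, F, hWu ▸ h⟩
  · obtain ⟨W', Q', B', F', hlt, h'⟩ := h.extend hT hi hWu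
    exact absurd (card_lt_card hlt)
      (hmax W' (mem_filter.2 ⟨mem_univ _, Q', B', F', h'⟩)).not_gt

end Packing

section Necessity

variable {V α σ : Type} [Fintype V] [DecidableEq V] [Fintype α] [DecidableEq α]
  [Fintype σ] [DecidableEq σ] {tl hd : α → V}

theorem DReach.exists_entering {F : Finset α} {u w : V} (h : DReach tl hd F u w) {Z : Finset V}
    (hu : u ∉ Z) (hw : w ∈ Z) : ∃ a ∈ F, tl a ∉ Z ∧ hd a ∈ Z := by
  induction h with
  | refl => exact absurd hw hu
  | @tail x y _ hstep ih =>
    by_cases hx : x ∈ Z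
    · exact ih hx
    · obtain ⟨a, ha, rfl, rfl⟩ := hstep
      exact ⟨a, ha, hx, hw⟩

variable {loc : σ → V} {T : Finset σ} {F : σ → Finset α} {U : σ → Finset V}

theorem card_outside_le_inDegB (harb : ∀ s ∈ T, IsArbor tl hd (F s) (loc s) (U s))
    (hdisj : ∀ s ∈ T, ∀ s' ∈ T, s ≠ s' → Disjoint (F s) (F s')) {Z : Finset V} {v : V}
    (hv : v ∈ Z) :
    (T.filter fun s => v ∈ U s ∧ loc s ∉ Z).card ≤ inDegB tl hd univ Z := by
  have hex : ∀ s ∈ T.filter fun s => v ∈ U s ∧ loc s ∉ Z, ∃ a ∈ F s, tl a ∉ Z ∧ hd a ∈ Z := by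
    intro s hs
    obtain ⟨hsT, hsv, hsZ⟩ := mem_filter.1 hs
    obtain ⟨x, hx, hr⟩ := (harb s hsT).2.2.2.2 v hsv
    obtain rfl := mem_singleton.1 hx
    exact DReach.exists_entering hr hsZ hv
  rcases isEmpty_or_nonempty α with hα | hα
  · have : (T.filter fun s => v ∈ U s ∧ loc s ∉ Z) = ∅ := by
      refine eq_empty_of_forall_notMem fun s hs => ?_
      obtain ⟨a, -⟩ := hex s hs
      exact hα.elim a
    simp [this]
  choose! f hf using hex
  refine card_le_card_of_injOn f
    (fun s hs => mem_coe.2 (mem_filter.2 ⟨mem_univ _, (hf s (mem_coe.1 hs)).2⟩)) ?_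
  intro s hs s' hs' heq
  by_contra hne
  have hs := mem_coe.1 hs
  have hs' := mem_coe.1 hs'
  exact disjoint_left.1 (hdisj s (mem_filter.1 hs).1 s' (mem_filter.1 hs').1 hne) (hf s hs).1
    (heq ▸ (hf s' hs').1)

theorem RankFn.r_union_le (M : RankFn σ) (A B : Finset σ) : M.r (A ∪ B) ≤ M.r A + M.r B :=
  (Nat.le_add_right _ _).trans (M.r_submod A B)

theorem PetalOf.rank_le_of_packing (M : RankFn σ)
    (harb : ∀ s ∈ T, IsArbor tl hd (F s) (loc s) (U s))
    (hdisj : ∀ s ∈ T, ∀ s' ∈ T, s ≠ s' → Disjoint (F s) (F s'))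
    (hbasis : ∀ v : V, IsBasisOf M.r (T.filter fun s => v ∈ U s) (SX loc (PReach tl hd {v})))
    {C O : Finset V} (hO : PetalOf tl hd C O) (I : Finset V) :
    M.r (SX loc (PReach tl hd C)) ≤
      (T ∩ SX loc I).card + M.r (SX loc (O \ I)) + inDegB tl hd univ O := by
  obtain ⟨v, hv⟩ := hO.2.1
  obtain ⟨hvO, hvC⟩ := mem_inter.1 hv
  have h1 := (hbasis v).2.2
  rw [PReach_eq_of_subset hO.1 (singleton_nonempty v) (singleton_subset_iff.2 hvC)] at h1
  have hsub : (T.filter fun s => v ∈ U s) ⊆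
      ((T ∩ SX loc I) ∪ SX loc (O \ I)) ∪ T.filter fun s => v ∈ U s ∧ loc s ∉ O := by
    intro s hs
    obtain ⟨hsT, hsv⟩ := mem_filter.1 hs
    by_cases hsO : loc s ∈ O
    · by_cases hsI : loc s ∈ I
      · exact mem_union_left _ (mem_union_left _ (mem_inter.2 ⟨hsT, mem_SX.2 hsI⟩))
      · exact mem_union_left _ (mem_union_right _ (mem_SX.2 (mem_sdiff.2 ⟨hsO, hsI⟩)))
    · exact mem_union_right _ (mem_filter.2 ⟨hsT, hsv, hsO⟩)
  have h2 := M.r_mono hsub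
  have h3 := M.r_union_le ((T ∩ SX loc I) ∪ SX loc (O \ I))
    (T.filter fun s => v ∈ U s ∧ loc s ∉ O)
  have h4 := M.r_union_le (T ∩ SX loc I) (SX loc (O \ I))
  have h5 := M.r_le_card (T ∩ SX loc I)
  have h6 := M.r_le_card (T.filter fun s => v ∈ U s ∧ loc s ∉ O)
  have h7 := card_outside_le_inDegB harb hdisj hvO
  omega

theorem card_le_sum_rank_of_packing (M : RankFn σ)
    (harb : ∀ s ∈ T, IsArbor tl hd (F s) (loc s) (U s))
    (hbasis : ∀ v : V, IsBasisOf M.r (T.filter fun s => v ∈ U s) (SX loc (PReach tl hd {v}))) :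
    T.card ≤ ∑ v : V, M.r (SX loc {v}) := by
  rw [← sum_card_inter_SX loc T]
  refine sum_le_sum fun v _ => ?_
  have hsub : T ∩ SX loc {v} ⊆ T.filter fun s => v ∈ U s := by
    intro s hs
    obtain ⟨hsT, hsv⟩ := mem_inter.1 hs
    obtain rfl := mem_singleton.1 (mem_SX.1 hsv)
    exact mem_filter.2 ⟨hsT, (harb s hsT).1 (mem_singleton_self _)⟩
  rw [← M.r_eq_card_of_subset hsub (hbasis v).2.1]
  exact M.r_mono inter_subset_right

theorem sum_card_inter_SX_le {P : Finset (Finset V × Finset V)}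
    (hsub : ∀ X ∈ P, X.2 ⊆ petalCore tl hd X.1)
    (hlam : ∀ X ∈ P, ∀ Y ∈ P, X ≠ Y → (petalCore tl hd X.1 ∩ petalCore tl hd Y.1).Nonempty →
      X.1 ⊆ Y.1 \ Y.2 ∨ Y.1 ⊆ X.1 \ X.2) :
    ∑ X ∈ P, (T ∩ SX loc X.2).card ≤ T.card := by
  rw [← card_biUnion]
  · exact card_le_card (biUnion_subset.2 fun X _ => inter_subset_left)
  · intro X hX Y hY hne
    refine disjoint_left.2 fun s hsX hsY => ?_
    have hsX := mem_SX.1 (mem_inter.1 hsX).2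
    have hsY := mem_SX.1 (mem_inter.1 hsY).2
    have hcX := hsub X hX hsX
    have hcY := hsub Y hY hsY
    rcases hlam X hX Y hY hne ⟨_, mem_inter.2 ⟨hcX, hcY⟩⟩ with h | h
    · exact (mem_sdiff.1 (h (mem_inter.1 hcX).2)).2 hsY
    · exact (mem_sdiff.1 (h (mem_inter.1 hcY).2)).2 hsX

end Necessity

/-- **Main theorem: `M`-reachability-based `(ℓ,ℓ')`-limited packing of
arborescences.** Such a packing exists iff (i) `ℓ ≤ ℓ'`,
(ii) `Σ_v r_M(S_v) ≥ ℓ`, (iii) `d⁻_A(X) ≥ p̂(X)` for every biset `X` on `V`, and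
(iv) for every OW-laminar family `𝒫` of generalized petal bisets,
`Σ_{X∈𝒫} (r_M(S_{P_{X_I}}) − r_M(S_{X_W}) − d⁻_A(X_O)) ≤ ℓ'`. -/
theorem matroid_reachability_based_limited_packing_of_arborescences
    {V α σ : Type} [Fintype V] [DecidableEq V] [Fintype α] [DecidableEq α]
    [Fintype σ] [DecidableEq σ]
    (tl hd : α → V) (loc : σ → V) (M : RankFn σ) (ℓ ℓ' : ℕ) :
    (∃ (T : Finset σ) (F : σ → Finset α) (U : σ → Finset V),
        (∀ s ∈ T, IsArbor tl hd (F s) (loc s) (U s)) ∧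
        (∀ s ∈ T, ∀ s' ∈ T, s ≠ s' → Disjoint (F s) (F s')) ∧
        (∀ v : V, IsBasisOf M.r (T.filter fun s => v ∈ U s)
          (SX loc (PReach tl hd {v}))) ∧
        ℓ ≤ T.card ∧ T.card ≤ ℓ')
    ↔ (ℓ ≤ ℓ' ∧
       ℓ ≤ ∑ v : V, M.r (SX loc {v}) ∧
       (∀ XO XI : Finset V, XI ⊆ XO →
          phatB tl hd loc M XO XI ≤ (bisetInDeg tl hd univ XO XI : ℤ)) ∧
       (∀ P : Finset (Finset V × Finset V),
          (∀ X ∈ P, IsPetal tl hd X.1 ∧ X.2.Nonempty ∧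
            X.2 ⊆ petalCore tl hd X.1) →
          (∀ X ∈ P, ∀ Y ∈ P, X ≠ Y →
            (petalCore tl hd X.1 ∩ petalCore tl hd Y.1).Nonempty →
            X.1 ⊆ Y.1 \ Y.2 ∨ Y.1 ⊆ X.1 \ X.2) →
          ∑ X ∈ P, ((M.r (SX loc (PReach tl hd X.2)) : ℤ)
              - M.r (SX loc (X.1 \ X.2)) - inDegB tl hd univ X.1)
            ≤ (ℓ' : ℤ))) := by
  constructor
  · rintro ⟨T, F, U, harb, hdisj, hbasis, hℓ, hℓ'⟩
    refine ⟨hℓ.trans hℓ', hℓ.trans (card_le_sum_rank_of_packing M harb hbasis),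
      fun XO XI _ => ?_, fun P hP hlam => ?_⟩
    · unfold phatB
      split_ifs with h
      · obtain ⟨hO, rfl⟩ := h
        have hO' := petalOf_petalAtom hO
        have h1 := hO'.rank_le_of_packing M harb hdisj hbasis ∅
        rw [sdiff_empty, show SX loc ∅ = ∅ by simp [SX], inter_empty, card_empty] at h1
        rw [hO'.petalCore_eq, hO'.bisetInDeg_eq]
        omega
      · exact Int.natCast_nonneg _
    · have h1 := sum_card_inter_SX_le (T := T) (loc := loc) (fun X hX => (hP X hX).2.2) hlam
      have h2 : ∑ X ∈ P, ((M.r (SX loc (PReach tl hd X.2)) : ℤ) - M.r (SX loc (X.1 \ X.2))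
          - inDegB tl hd univ X.1) ≤ ∑ X ∈ P, ((T ∩ SX loc X.2).card : ℤ) := by
        refine sum_le_sum fun X hX => ?_
        obtain ⟨hO, hne, hsub⟩ := hP X hX
        have hO' := petalOf_petalAtom hO
        have h3 := hO'.rank_le_of_packing M harb hdisj hbasis X.2
        rw [PReach_eq_of_subset hO'.1 hne (hsub.trans inter_subset_left)]
        omega
      refine h2.trans ?_
      exact_mod_cast h1.trans hℓ'
  · rintro ⟨hℓ, hsum, hbiset, hfam⟩
    obtain ⟨T₀, hc₀, hT₀⟩ := exists_rootsSuffice loc M ℓ' (fun C O hO => by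
      have h1 := hbiset O (petalCore tl hd O) inter_subset_right
      rw [phatB, if_pos ⟨hO.isPetal, rfl⟩, hO.petalAtom_eq, hO.petalCore_eq,
        hO.bisetInDeg_eq] at h1
      omega) hfam
    obtain ⟨T, hcl, hcu, hT, hi⟩ := hT₀.exists_locallyIndep_card hc₀ hℓ hsum
    obtain ⟨Q, B, F, h⟩ := exists_completeOn_univ hT hi
    refine ⟨T, F, fun s => univ.filter fun v => s ∈ Q v, h.packing.arbor, h.packing.disjoint,
      fun v => ?_, hcl, hcu⟩
    have : (T.filter fun s => v ∈ univ.filter fun v => s ∈ Q v) = Q v := by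
      ext s
      simp only [mem_filter, mem_univ, true_and]
      exact ⟨fun h => h.2, fun hs => ⟨h.packing.subset v hs, hs⟩⟩
    rw [this]
    exact h.basis v (mem_univ v)
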